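/- arXiv:2404.07384 — 3 statements merged into one kernel-verified Lean document; each statement's English description precedes it below -/
import Mathlib

section
/- For n > 2 even and every integer m > 0, the meromorphic continuation in s of I_m(s) = (Γ(n/2+s+1)/(Γ(n/2)Γ(s+1))) ∫₀¹ t^{m+n/2-1}(1-t)^s S_m(t)² dt has a simple pole at s = -n with residue (n-1)_m/Γ(m). -/
open MeasureTheory Real Filter Topology

/-- Pochhammer symbol (rising factorial) `(x)_k = x(x+1)⋯(x+k-1)`. -/
noncomputable def poch (x : ℝ) (k : ℕ) : ℝ := ∏ i ∈ Finset.range k, (x + i)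

/-- Gauss hypergeometric function `₂F₁(a,b;c;t)` as a series. -/
noncomputable def hyp2F1 (a b c t : ℝ) : ℝ :=
  ∑' k : ℕ, poch a k * poch b k / (poch c k * (Nat.factorial k)) * t ^ k

/-- The radial part `S_m(t) = ((n-1)_m/(n/2)_m) ₂F₁(m, 1-n/2; m+n/2; t)`. -/
noncomputable def Sfun (n : ℝ) (m : ℕ) (t : ℝ) : ℝ :=
  (poch (n - 1) m / poch (n / 2) m) * hyp2F1 m (1 - n / 2) (m + n / 2) t

/-- `I_m(s) = (Γ(n/2+s+1)/(Γ(n/2)Γ(s+1))) ∫₀¹ t^{m+n/2-1}(1-t)^s S_m(t)² dt`, for `s > -1`. -/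
noncomputable def Ifun (n : ℝ) (m : ℕ) (s : ℝ) : ℝ :=
  (Real.Gamma (n / 2 + s + 1) / (Real.Gamma (n / 2) * Real.Gamma (s + 1))) *
    ∫ t in Set.Ioo (0:ℝ) 1, t ^ ((m:ℝ) + n / 2 - 1) * (1 - t) ^ s * (Sfun n m t) ^ 2

open Polynomial in
theorem coeff_taylor_one_X_pow_mul (a j : ℕ) (R : ℝ[X]) {d : ℕ} (hd : R.natDegree < d) :
    (taylor 1 (X ^ a * R)).coeff j =
      ∑ i ∈ Finset.range d, R.coeff i * ((a + i).choose j : ℝ) := by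
  conv_lhs => rw [R.as_sum_range' d hd, Finset.mul_sum]
  rw [map_sum, finsetSum_coeff]
  refine Finset.sum_congr rfl fun i _ => ?_
  rw [X_pow_mul_monomial, taylor_coeff, hasseDeriv_monomial]
  simp [mul_comm, add_comm]

theorem poch_natCast_add_one_mul_factorial (a k : ℕ) :
    poch ((a : ℝ) + 1) k * a.factorial = (a + k).factorial := by
  induction k with
  | zero => simp [poch]
  | succ k ih =>
    rw [poch, Finset.prod_range_succ, ← poch, mul_right_comm, ih, ← add_assoc, Nat.factorial_succ]
    push_cast
    ring

theorem poch_neg_natCast_mul_factorial {q k : ℕ} (hk : k ≤ q) :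
    poch (-(q : ℝ)) k * (q - k).factorial = (-1) ^ k * q.factorial := by
  induction k with
  | zero => simp [poch]
  | succ k ih =>
    have h1 : q - k = (q - (k + 1)) + 1 := by omega
    have h2 : ((q - (k + 1) : ℕ) : ℝ) = q - (k + 1) := by
      rw [Nat.cast_sub hk]; push_cast; ring
    have ih := ih (by omega)
    rw [h1, Nat.factorial_succ] at ih
    push_cast at ih
    rw [h2] at ih
    rw [poch, Finset.prod_range_succ, ← poch, pow_succ]
    linear_combination -ih

theorem poch_neg_natCast_eq_zero {q k : ℕ} (hk : q < k) : poch (-(q : ℝ)) k = 0 :=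
  Finset.prod_eq_zero (Finset.mem_range.2 hk) (by simp)

theorem choose_neg_natCast_mul_factorial (m k : ℕ) :
    ((Ring.choose (-(m : ℤ)) k : ℤ) : ℝ) * k.factorial = (-1) ^ k * poch m k := by
  have h := Ring.descPochhammer_eq_factorial_smul_choose (-(m : ℤ)) k
  have h2 : (((descPochhammer ℤ k).smeval (-(m : ℤ)) : ℤ) : ℝ) = (-1) ^ k * poch m k := by
    clear h
    induction k with
    | zero => simp [poch]
    | succ k ih =>
      rw [descPochhammer_succ_right, Polynomial.smeval_mul, poch, Finset.prod_range_succ, ← poch]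
      push_cast
      rw [ih]
      simp [Polynomial.smeval_sub, Polynomial.smeval_natCast]
      ring
  rw [h] at h2
  rw [← h2]
  simp [mul_comm]

theorem Gamma_add_natCast_eq_poch_mul {x : ℝ} (hx : 0 < x) (k : ℕ) :
    Real.Gamma (x + k) = poch x k * Real.Gamma x := by
  induction k with
  | zero => simp [poch]
  | succ k ih =>
    rw [Nat.cast_succ, ← add_assoc, Real.Gamma_add_one (by positivity), ih, poch, poch,
      Finset.prod_range_succ]
    ring

/-- The summand of the polynomial form of `S_m`, up to normalization. -/
noncomputable def radialCoeff (q m k : ℕ) : ℝ :=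
  ((m + 2 * q).choose (q - k) : ℝ) * (Ring.choose (-(m : ℤ)) k : ℤ)

open Polynomial in
/-- The polynomial in `t` that `S_m` is equal to when `n = 2 * q + 2`. -/
noncomputable def radialPoly (q m : ℕ) : ℝ[X] :=
  ∑ k ∈ Finset.range (q + 1),
    monomial k ((q.factorial : ℝ) ^ 2 / (2 * q).factorial * radialCoeff q m k)

theorem coeff_radialPoly {q m k : ℕ} (hk : k < q + 1) :
    (radialPoly q m).coeff k = (q.factorial : ℝ) ^ 2 / (2 * q).factorial * radialCoeff q m k := by
  simp [radialPoly, Polynomial.finsetSum_coeff, Polynomial.coeff_monomial]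
  omega

theorem natDegree_radialPoly_lt (q m : ℕ) : (radialPoly q m).natDegree < q + 1 := by
  refine Nat.lt_succ_of_le (Polynomial.natDegree_sum_le_of_forall_le _ _ fun k hk => ?_)
  exact (Polynomial.natDegree_monomial_le _).trans (Finset.mem_range_succ_iff.1 hk)

theorem Sfun_eq_eval_radialPoly (q m : ℕ) (t : ℝ) :
    Sfun (2 * q + 2) m t = (radialPoly q m).eval t := by
  have e1 : (2 * (q : ℝ) + 2) / 2 = q + 1 := by ring
  have e2 : (1 : ℝ) - (q + 1) = -q := by ring
  have e3 : (2 * (q : ℝ) + 2) - 1 = (2 * q : ℕ) + 1 := by push_cast; ring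
  have e4 : (m : ℝ) + (q + 1) = (m + q : ℕ) + 1 := by push_cast; ring
  rw [Sfun, e1, e2, e3, e4, hyp2F1, tsum_eq_sum (s := Finset.range (q + 1)), radialPoly,
    Polynomial.eval_finsetSum, Finset.mul_sum]
  · refine Finset.sum_congr rfl fun k hk => ?_
    have hk := Finset.mem_range_succ_iff.1 hk
    rw [Polynomial.eval_monomial, radialCoeff, ← mul_assoc]
    congr 1
    have f0 (a : ℕ) : (a.factorial : ℝ) ≠ 0 := by exact_mod_cast a.factorial_ne_zero
    have h1 := poch_natCast_add_one_mul_factorial (2 * q) m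
    have h2 := poch_natCast_add_one_mul_factorial q m
    have h3 := poch_natCast_add_one_mul_factorial (m + q) k
    have h4 := poch_neg_natCast_mul_factorial hk
    have h5 := choose_neg_natCast_mul_factorial m k
    have h6 : ((m + 2 * q).choose (q - k) : ℝ) * (q - k).factorial * (m + q + k).factorial =
        (m + 2 * q).factorial := by
      rw [← Nat.choose_mul_factorial_mul_factorial (show q - k ≤ m + 2 * q by omega),
        show m + 2 * q - (q - k) = m + q + k by omega]
      push_cast
      ring
    rw [add_comm (2 * q)] at h1
    rw [add_comm q m] at h2
    rw [← eq_div_iff (f0 _)] at h1 h2 h3 h4 h5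
    rw [mul_assoc, ← eq_div_iff (mul_ne_zero (f0 _) (f0 _))] at h6
    rw [h1, h2, h3, h4, h5, h6]
    have := f0 q
    have := f0 k
    have := f0 (2 * q)
    have := f0 (m + q)
    have := f0 (q - k)
    have := f0 (m + q + k)
    have := f0 (m + 2 * q)
    field_simp
  · intro k hk
    rw [poch_neg_natCast_eq_zero (by simpa using hk)]
    simp

theorem coeff_taylor_one_X_pow_mul_radialPoly {q m j : ℕ} (hj : j ≤ m + 2 * q) :
    (Polynomial.taylor 1 (Polynomial.X ^ (m + q) * radialPoly q m)).coeff j =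
      (q.factorial : ℝ) ^ 2 / (2 * q).factorial * ((m + 2 * q).choose j *
        (Ring.choose ((2 * q : ℤ) - j) q : ℤ)) := by
  rw [coeff_taylor_one_X_pow_mul _ _ _ (natDegree_radialPoly_lt q m),
    show (2 * q : ℤ) - j = -(m : ℤ) + ((m + 2 * q - j : ℕ) : ℤ) by push_cast [hj]; ring,
    Ring.add_choose_eq _ (Commute.all _ _), Finset.Nat.sum_antidiagonal_eq_sum_range_succ_mk]
  push_cast
  rw [Finset.mul_sum, Finset.mul_sum]
  refine Finset.sum_congr rfl fun k hk => ?_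
  have hk' := Finset.mem_range_succ_iff.1 hk
  rw [coeff_radialPoly (Finset.mem_range.1 hk), radialCoeff, Ring.choose_natCast]
  have h : (m + 2 * q).choose (q - k) * (m + q + k).choose j =
      (m + 2 * q).choose j * (m + 2 * q - j).choose (q - k) := by
    rcases le_or_gt j (m + q + k) with h | h
    · rw [← Nat.choose_symm (show q - k ≤ m + 2 * q by omega),
        show m + 2 * q - (q - k) = m + q + k by omega,
        Nat.choose_mul h,
        ← Nat.choose_symm (show m + q + k - j ≤ m + 2 * q - j by omega)]
      congr 2
      omega
    · rw [Nat.choose_eq_zero_of_lt h, Nat.choose_eq_zero_of_lt (show m + 2 * q - j < q - k by omega)]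
      simp
  have h : ((m + 2 * q).choose (q - k) : ℝ) * (m + q + k).choose j =
      (m + 2 * q).choose j * (m + 2 * q - j).choose (q - k) := by exact_mod_cast h
  push_cast
  linear_combination (q.factorial : ℝ) ^ 2 / (2 * q).factorial * (Ring.choose (-(m : ℤ)) k : ℤ) * h

theorem coeff_taylor_one_radialPoly_sq {q m : ℕ} (hm : 0 < m) :
    (Polynomial.taylor 1 (Polynomial.X ^ (m + q) * radialPoly q m ^ 2)).coeff (2 * q + 1) =
      (q.factorial : ℝ) ^ 2 / (2 * q).factorial * ((m + 2 * q).choose (2 * q + 1) * (-1) ^ q) := by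
  have hS : (Polynomial.taylor 1 (radialPoly q m)).coeff 0 = 1 := by
    have h := coeff_taylor_one_X_pow_mul_radialPoly (q := q) (m := m) (j := 0) (by omega)
    rw [Polynomial.taylor_coeff_zero] at h ⊢
    rw [Polynomial.eval_mul, Polynomial.eval_pow, Polynomial.eval_X, one_pow, one_mul] at h
    rw [h, show (2 * q : ℤ) - (0 : ℕ) = ((2 * q : ℕ) : ℤ) by push_cast; ring, Ring.choose_natCast]
    have h := Nat.choose_mul_factorial_mul_factorial (show q ≤ 2 * q by omega)
    rw [show 2 * q - q = q by omega] at h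
    have h : ((2 * q).choose q : ℝ) * q.factorial * q.factorial = (2 * q).factorial := by
      exact_mod_cast h
    have f0 : ((2 * q).factorial : ℝ) ≠ 0 := by exact_mod_cast Nat.factorial_ne_zero _
    push_cast
    rw [Nat.choose_zero_right]
    field_simp
    push_cast
    linear_combination h
  rw [pow_two, ← mul_assoc, Polynomial.taylor_mul, Polynomial.coeff_mul,
    Finset.sum_eq_single (2 * q + 1, 0)]
  · rw [hS, coeff_taylor_one_X_pow_mul_radialPoly (by omega),
      show (2 * q : ℤ) - (2 * q + 1 : ℕ) = -1 by push_cast; ring, Ring.choose_neg]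
    have : Ring.choose ((1 : ℤ) + q - 1) q = 1 := by
      rw [add_sub_cancel_left, Ring.choose_natCast]; simp
    rw [this]
    simp [Units.smul_def]
  · rintro ⟨a, b⟩ hab hne
    have hab := Finset.HasAntidiagonal.mem_antidiagonal.1 hab
    dsimp only at hab ⊢
    rcases lt_or_ge q b with hb | hb
    · rw [Polynomial.coeff_eq_zero_of_natDegree_lt (p := Polynomial.taylor 1 (radialPoly q m)),
        mul_zero]
      rw [Polynomial.natDegree_taylor]
      have := natDegree_radialPoly_lt q m
      omega
    · have hb0 : b ≠ 0 := by
        rintro rfl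
        exact hne (by simp at hab; simp [hab])
      rw [coeff_taylor_one_X_pow_mul_radialPoly (by omega),
        show (2 * q : ℤ) - a = ((b - 1 : ℕ) : ℤ) by omega, Ring.choose_natCast,
        Nat.choose_eq_zero_of_lt (show b - 1 < q by omega)]
      simp
  · intro h
    exact absurd (by simp) h

theorem integrableOn_rpow_mul_one_sub_rpow {u v : ℝ} (hu : 0 < u) (hv : 0 < v) :
    IntegrableOn (fun t : ℝ => t ^ (u - 1) * (1 - t) ^ (v - 1)) (Set.Ioo 0 1) := by
  have h := (Complex.betaIntegral_convergent (u := u) (v := v) (by simpa) (by simpa))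
  rw [intervalIntegrable_iff_integrableOn_Ioo_of_le zero_le_one] at h
  refine IntegrableOn.congr_fun (Integrable.re h) (fun t ht => ?_) measurableSet_Ioo
  have e : (t : ℂ) ^ ((u : ℂ) - 1) * (1 - (t : ℂ)) ^ ((v : ℂ) - 1) =
      ((t ^ (u - 1) * (1 - t) ^ (v - 1) : ℝ) : ℂ) := by
    rw [Complex.ofReal_mul, Complex.ofReal_cpow ht.1.le, Complex.ofReal_cpow (by linarith [ht.2])]
    push_cast
    rfl
  rw [e]
  exact RCLike.ofReal_re _

theorem integral_rpow_mul_one_sub_rpow {u v : ℝ} (hu : 0 < u) (hv : 0 < v) :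
    ∫ t in Set.Ioo (0 : ℝ) 1, t ^ (u - 1) * (1 - t) ^ (v - 1) =
      Real.Gamma u * Real.Gamma v / Real.Gamma (u + v) := by
  have h := Complex.betaIntegral_eq_Gamma_mul_div u v (by simpa) (by simpa)
  rw [Complex.betaIntegral, intervalIntegral.integral_of_le zero_le_one,
    integral_Ioc_eq_integral_Ioo, Complex.Gamma_ofReal, Complex.Gamma_ofReal, ← Complex.ofReal_add,
    Complex.Gamma_ofReal] at h
  rw [← Complex.ofReal_inj]
  rw [Complex.ofReal_div, Complex.ofReal_mul, ← h, ← integral_complex_ofReal]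
  refine setIntegral_congr_fun measurableSet_Ioo fun t ht => ?_
  rw [Complex.ofReal_mul, Complex.ofReal_cpow ht.1.le, Complex.ofReal_cpow (by linarith [ht.2])]
  push_cast
  rfl

theorem Gamma_mul_integral_rpow_mul_eval (q m : ℕ) (R : Polynomial ℝ) {d : ℕ}
    (hd : R.natDegree < d) {s : ℝ} (hs : -1 < s) :
    Real.Gamma (q + 1 + s + 1) / (Real.Gamma (q + 1) * Real.Gamma (s + 1)) *
        ∫ t in Set.Ioo (0 : ℝ) 1, t ^ ((m : ℝ) + q) * (1 - t) ^ s * R.eval t =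
      ∑ j ∈ Finset.range d, R.coeff j * ((m + q + j).factorial / q.factorial) /
        poch (s + q + 2) (m + j) := by
  have hs' : 0 < s + 1 := by linarith
  have hu (j : ℕ) : (0 : ℝ) < (m + q + j : ℕ) + 1 := by positivity
  have e : Set.EqOn (fun t : ℝ => t ^ ((m : ℝ) + q) * (1 - t) ^ s * R.eval t)
      (fun t => ∑ j ∈ Finset.range d, R.coeff j *
        (t ^ (((m + q + j : ℕ) + 1 : ℝ) - 1) * (1 - t) ^ (s + 1 - 1))) (Set.Ioo 0 1) := by
    intro t ht
    dsimp only
    rw [Polynomial.eval_eq_sum_range' hd, Finset.mul_sum]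
    refine Finset.sum_congr rfl fun j _ => ?_
    rw [add_sub_cancel_right, add_sub_cancel_right, Nat.cast_add _ j, Nat.cast_add m q,
      Real.rpow_add ht.1 _ (j : ℝ), Real.rpow_natCast]
    ring
  rw [setIntegral_congr_fun measurableSet_Ioo e, integral_finsetSum _ fun j _ =>
    (integrableOn_rpow_mul_one_sub_rpow (hu j) hs').const_mul _, Finset.mul_sum]
  refine Finset.sum_congr rfl fun j _ => ?_
  have hx : (0 : ℝ) < s + q + 2 := by linarith [q.cast_nonneg (α := ℝ)]
  have h := Gamma_add_natCast_eq_poch_mul hx (m + j)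
  rw [integral_const_mul, integral_rpow_mul_one_sub_rpow (hu j) hs', Real.Gamma_nat_eq_factorial,
    Real.Gamma_nat_eq_factorial,
    show ((m + q + j : ℕ) + 1 + (s + 1) : ℝ) = s + q + 2 + (m + j : ℕ) by push_cast; ring, h,
    show (q + 1 + s + 1 : ℝ) = s + q + 2 by ring]
  have h1 := (Real.Gamma_pos_of_pos hx).ne'
  have h2 := (Real.Gamma_pos_of_pos hs').ne'
  field_simp

theorem tendsto_mul_inv_prod_add (q N : ℕ) :
    Tendsto (fun s : ℂ => (s + (2 * q + 2 : ℕ)) * (∏ r ∈ Finset.range N, (s + q + 2 + r))⁻¹)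
      (𝓝[≠] (-((2 * q + 2 : ℕ) : ℂ)))
      (𝓝 ((-1) ^ q * (2 * q + 1).factorial * (N + q).choose (2 * q + 1) /
        (q.factorial * (N + q).factorial))) := by
  have f0 (a : ℕ) : (a.factorial : ℂ) ≠ 0 := by exact_mod_cast a.factorial_ne_zero
  have hprod (k : ℕ) (hk : k ≤ q) :
      ∏ r ∈ Finset.range k, (-((2 * q + 2 : ℕ) : ℂ) + q + 2 + r) ≠ 0 := by
    refine Finset.prod_ne_zero_iff.2 fun r hr => ?_
    have hr := Finset.mem_range.1 hr
    rw [show -((2 * q + 2 : ℕ) : ℂ) + q + 2 + r = ((r : ℤ) - q : ℤ) by push_cast; ring]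
    exact_mod_cast (by omega : (r : ℤ) - q ≠ 0)
  rcases le_or_gt N q with hN | hN
  · rw [Nat.choose_eq_zero_of_lt (by omega)]
    have : ContinuousAt (fun s : ℂ => (s + (2 * q + 2 : ℕ)) *
        (∏ r ∈ Finset.range N, (s + q + 2 + r))⁻¹) (-((2 * q + 2 : ℕ) : ℂ)) := by
      refine ContinuousAt.mul (by fun_prop) (ContinuousAt.inv₀ (by fun_prop) (hprod N hN))
    convert! this.tendsto.mono_left nhdsWithin_le_nhds using 2
    simp
  · obtain ⟨k, rfl⟩ := Nat.exists_eq_add_of_lt hN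
    set F : ℂ → ℂ := fun s => (∏ r ∈ Finset.range q, (s + q + 2 + r)) *
      ∏ r ∈ Finset.range k, (s + q + 2 + (q + 1 + r : ℕ)) with hF
    have h1 : ∏ r ∈ Finset.range q, (-((2 * q + 2 : ℕ) : ℂ) + q + 2 + r) =
        (-1) ^ q * q.factorial := by
      rw [← Finset.prod_range_add_one_eq_factorial, ← Finset.prod_range_reflect]
      push_cast
      rw [← Finset.card_range q, ← Finset.prod_const, Finset.card_range, ← Finset.prod_mul_distrib]
      refine Finset.prod_congr rfl fun r hr => ?_
      have hr := Finset.mem_range.1 hr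
      rw [Nat.sub_sub, Nat.cast_sub (by omega)]
      push_cast
      ring
    have h2 : ∏ r ∈ Finset.range k, (-((2 * q + 2 : ℕ) : ℂ) + q + 2 + (q + 1 + r : ℕ)) =
        k.factorial := by
      rw [← Finset.prod_range_add_one_eq_factorial]
      push_cast
      refine Finset.prod_congr rfl fun r hr => ?_
      ring
    have hF0 : F (-((2 * q + 2 : ℕ) : ℂ)) = (-1) ^ q * q.factorial * k.factorial := by
      rw [hF]; dsimp only; rw [h1, h2]
    have hFne : F (-((2 * q + 2 : ℕ) : ℂ)) ≠ 0 := by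
      rw [hF0]
      exact mul_ne_zero (mul_ne_zero (pow_ne_zero _ (by norm_num)) (f0 _)) (f0 _)
    have hc : ContinuousAt (fun s => (F s)⁻¹) (-((2 * q + 2 : ℕ) : ℂ)) :=
      ContinuousAt.inv₀ (by fun_prop) hFne
    have hval : (-1) ^ q * ((2 * q + 1).factorial : ℂ) * (q + k + 1 + q).choose (2 * q + 1) /
        (q.factorial * (q + k + 1 + q).factorial) = (F (-((2 * q + 2 : ℕ) : ℂ)))⁻¹ := by
      have h := Nat.choose_mul_factorial_mul_factorial
        (show 2 * q + 1 ≤ q + k + 1 + q by omega)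
      rw [show q + k + 1 + q - (2 * q + 1) = k by omega] at h
      have h : ((q + k + 1 + q).choose (2 * q + 1) : ℂ) * (2 * q + 1).factorial * k.factorial =
          (q + k + 1 + q).factorial := by exact_mod_cast h
      have hs : ((-1 : ℂ) ^ q) * (-1) ^ q = 1 := by rw [← mul_pow]; simp
      rw [hF0, ← one_div, div_eq_div_iff (mul_ne_zero (f0 _) (f0 _)) (hF0 ▸ hFne), ← h]
      linear_combination ((2 * q + 1).factorial : ℂ) * (q + k + 1 + q).choose (2 * q + 1) *
        q.factorial * k.factorial * hs
    rw [hval]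
    refine (hc.tendsto.mono_left nhdsWithin_le_nhds).congr' ?_
    filter_upwards [self_mem_nhdsWithin] with s hs
    have hs : s + (2 * q + 2 : ℕ) ≠ 0 := fun h => hs (eq_neg_of_add_eq_zero_left h)
    rw [show q + k + 1 = q + 1 + k by ring, Finset.prod_range_add, Finset.prod_range_succ,
      show s + q + 2 + q = s + (2 * q + 2 : ℕ) by push_cast; ring, hF]
    field_simp

/-- for `n > 2` even and `m > 0`, the meromorphic continuation of `I_m(s)`
has a simple pole at `s = -n` with residue `(n-1)_m/Γ(m)`. -/
theorem Ifun_residue_even (n : ℕ) (hn : 2 < n) (hne : Even n) (m : ℕ) (hm : 0 < m) :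
    ∃ G : ℂ → ℂ, MeromorphicOn G Set.univ ∧
      (∀ s : ℝ, -1 < s → G s = (Ifun n m s : ℂ)) ∧
      Tendsto (fun s : ℂ => (s + n) * G s) (𝓝[≠] (-(n:ℂ)))
        (𝓝 ((poch ((n:ℝ) - 1) m / Real.Gamma m : ℝ) : ℂ)) := by
  obtain ⟨q, rfl⟩ : ∃ q, n = 2 * q + 2 := by
    obtain ⟨r, rfl⟩ := hne
    exact ⟨r - 1, by omega⟩
  set R := radialPoly q m ^ 2 with hR
  refine ⟨fun s => ∑ j ∈ Finset.range (R.natDegree + 1),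
    (R.coeff j * ((m + q + j).factorial / q.factorial) : ℝ) *
      (∏ r ∈ Finset.range (m + j), (s + q + 2 + r))⁻¹, ?_, ?_, ?_⟩
  · intro s _
    refine MeromorphicAt.fun_sum fun j _ => (MeromorphicAt.const _ _).mul (MeromorphicAt.inv ?_)
    exact MeromorphicAt.fun_prod fun r _ => by fun_prop
  · intro s hs
    have hn2 : ((2 * q + 2 : ℕ) : ℝ) = 2 * q + 2 := by push_cast; ring
    rw [Ifun, hn2, show (2 * (q : ℝ) + 2) / 2 = q + 1 by ring, ← add_assoc (m : ℝ),
      add_sub_cancel_right]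
    simp_rw [Sfun_eq_eval_radialPoly, ← Polynomial.eval_pow]
    rw [Gamma_mul_integral_rpow_mul_eval q m _ (Nat.lt_succ_self _) hs]
    push_cast [poch, div_eq_mul_inv]
    rfl
  · have hlim : ((poch (((2 * q + 2 : ℕ) : ℝ) - 1) m / Real.Gamma m : ℝ) : ℂ) =
        ∑ j ∈ Finset.range (R.natDegree + 1),
          ((R.coeff j * ((m + q + j).factorial / q.factorial) : ℝ) : ℂ) *
            ((-1 : ℂ) ^ q * (2 * q + 1).factorial * (m + j + q).choose (2 * q + 1) /
              (q.factorial * (m + j + q).factorial)) := by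
      have h := coeff_taylor_one_X_pow_mul (m + q) (2 * q + 1) R (Nat.lt_succ_self _)
      rw [hR, coeff_taylor_one_radialPoly_sq hm, ← hR] at h
      have f0 (a : ℕ) : (a.factorial : ℝ) ≠ 0 := by exact_mod_cast a.factorial_ne_zero
      have hs : ((-1 : ℝ) ^ q) * (-1) ^ q = 1 := by rw [← mul_pow]; simp
      have hsum : ∑ j ∈ Finset.range (R.natDegree + 1),
          (R.coeff j * ((m + q + j).factorial / q.factorial) : ℝ) *
            ((-1) ^ q * (2 * q + 1).factorial * (m + j + q).choose (2 * q + 1) /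
              (q.factorial * (m + j + q).factorial)) =
          (-1) ^ q * (2 * q + 1).factorial / (q.factorial : ℝ) ^ 2 *
            ((q.factorial : ℝ) ^ 2 / (2 * q).factorial *
              ((m + 2 * q).choose (2 * q + 1) * (-1) ^ q)) := by
        rw [h, Finset.mul_sum]
        refine Finset.sum_congr rfl fun j _ => ?_
        rw [add_right_comm m j q]
        have := f0 q
        have := f0 (m + q + j)
        field_simp
      have hval : poch (((2 * q + 2 : ℕ) : ℝ) - 1) m / Real.Gamma m =
          (-1) ^ q * (2 * q + 1).factorial / (q.factorial : ℝ) ^ 2 *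
            ((q.factorial : ℝ) ^ 2 / (2 * q).factorial *
              ((m + 2 * q).choose (2 * q + 1) * (-1) ^ q)) := by
        obtain ⟨l, rfl⟩ := Nat.exists_eq_add_of_lt hm
        rw [zero_add, Nat.cast_succ l, Real.Gamma_nat_eq_factorial,
          show ((2 * q + 2 : ℕ) : ℝ) - 1 = (2 * q : ℕ) + 1 by push_cast; ring]
        have h1 := poch_natCast_add_one_mul_factorial (2 * q) (l + 1)
        have h2 := Nat.choose_mul_factorial_mul_factorial
          (show 2 * q + 1 ≤ l + 1 + 2 * q by omega)
        rw [show l + 1 + 2 * q - (2 * q + 1) = l by omega] at h2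
        have h2 : ((l + 1 + 2 * q).choose (2 * q + 1) : ℝ) * (2 * q + 1).factorial * l.factorial =
          (l + 1 + 2 * q).factorial := by exact_mod_cast h2
        rw [add_comm (2 * q), ← h2] at h1
        have := f0 q
        have := f0 l
        have := f0 (2 * q)
        rw [← eq_div_iff this] at h1
        rw [h1]
        field_simp
        linear_combination -((l + 1 + 2 * q).choose (2 * q + 1) : ℝ) * hs
      rw [hval, ← hsum]
      push_cast
      rfl
    rw [hlim]
    refine (tendsto_finsetSum _ fun j _ =>
      (tendsto_mul_inv_prod_add q (m + j)).const_mul _).congr fun s => ?_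
    rw [Finset.mul_sum]
    refine Finset.sum_congr rfl fun j _ => ?_
    ring
end

section
/- For n > 2 odd and every integer m > 0, the meromorphic continuation in s of I_m(s) = (Γ(n/2+s+1)/(Γ(n/2)Γ(s+1))) ∫₀¹ t^{m+n/2-1}(1-t)^s S_m(t)² dt has a simple pole at s = -n with residue 2(n-1)_m/Γ(m). -/
open MeasureTheory Real Filter Topology

/-- The Mellin transform of `g` restricted to `(0, 1/2]`. -/
noncomputable def halfMellin (g : ℝ → ℂ) : ℂ → ℂ :=
  mellin ((Set.Ioc 0 (1 / 2)).indicator g)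

lemma half_locallyIntegrableOn {g : ℝ → ℂ} (hg : ContinuousOn g (Set.Icc 0 (1 / 2))) :
    LocallyIntegrableOn ((Set.Ioc 0 (1 / 2)).indicator g) (Set.Ioi 0) := by
  have h : IntegrableOn g (Set.Ioc 0 (1 / 2)) :=
    (hg.integrableOn_compact isCompact_Icc).mono_set Set.Ioc_subset_Icc_self
  exact (h.integrable_indicator measurableSet_Ioc).locallyIntegrable.locallyIntegrableOn _

lemma half_isBigO_atTop (g : ℝ → ℂ) (a : ℝ) :
    (Set.Ioc 0 (1 / 2)).indicator g =O[atTop] (fun x : ℝ => x ^ (-a)) := by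
  refine EventuallyEq.trans_isBigO ?_ (Asymptotics.isBigO_zero _ _)
  filter_upwards [eventually_gt_atTop (1 / 2)] with x hx
  exact Set.indicator_of_notMem (fun h => absurd h.2 (not_le.2 hx)) _

lemma half_isBigO_zero {g : ℝ → ℂ} (hg : ContinuousOn g (Set.Icc 0 (1 / 2))) :
    (Set.Ioc 0 (1 / 2)).indicator g =O[𝓝[>] 0] (fun x : ℝ => x ^ (-(0 : ℝ))) := by
  obtain ⟨C, hC⟩ := isCompact_Icc.exists_bound_of_continuousOn hg
  refine Asymptotics.IsBigO.of_bound C ?_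
  filter_upwards [Ioc_mem_nhdsGT (show (0 : ℝ) < 1 / 2 by norm_num)] with x hx
  rw [Set.indicator_of_mem hx]
  simpa using hC x (Set.Ioc_subset_Icc_self hx)

lemma halfMellin_hasDerivAt {g : ℝ → ℂ} (hg : ContinuousOn g (Set.Icc 0 (1 / 2))) {s : ℂ}
    (hs : 0 < s.re) :
    MellinConvergent (fun t => log t • (Set.Ioc 0 (1 / 2)).indicator g t) s ∧
      HasDerivAt (halfMellin g) (mellin (fun t => log t • (Set.Ioc 0 (1 / 2)).indicator g t) s) s :=
  mellin_hasDerivAt_of_isBigO_rpow (half_locallyIntegrableOn hg) (half_isBigO_atTop g (s.re + 1))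
    (by linarith) (half_isBigO_zero hg) hs

lemma halfMellin_convergent {g : ℝ → ℂ} (hg : ContinuousOn g (Set.Icc 0 (1 / 2))) {s : ℂ}
    (hs : 0 < s.re) : MellinConvergent ((Set.Ioc 0 (1 / 2)).indicator g) s :=
  mellinConvergent_of_isBigO_rpow (half_locallyIntegrableOn hg) (half_isBigO_atTop g (s.re + 1))
    (by linarith) (half_isBigO_zero hg) hs

lemma halfMellin_hasDerivAt_log {g : ℝ → ℂ} (hg : ContinuousOn g (Set.Icc 0 (1 / 2))) {s : ℂ}
    (hs : 0 < s.re) :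
    MellinConvergent (fun t => log t • (log t • (Set.Ioc 0 (1 / 2)).indicator g t)) s ∧
      HasDerivAt (mellin (fun t => log t • (Set.Ioc 0 (1 / 2)).indicator g t))
        (mellin (fun t => log t • (log t • (Set.Ioc 0 (1 / 2)).indicator g t)) s) s := by
  refine mellin_hasDerivAt_of_isBigO_rpow (a := s.re + 1) (b := s.re / 2) ?_
    (isBigO_rpow_top_log_smul (lt_add_one _) (half_isBigO_atTop g (s.re + 1 + 1)))
    (by linarith) (isBigO_rpow_zero_log_smul (by linarith) (half_isBigO_zero hg)) (by linarith)
  exact (half_locallyIntegrableOn hg).continuousOn_smul isOpen_Ioi.isLocallyClosed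
    (continuousOn_log.mono fun x hx => ne_of_gt hx)

lemma halfMellin_eq_intervalIntegral (g : ℝ → ℂ) (s : ℂ) :
    halfMellin g s = ∫ x in (0 : ℝ)..(1 / 2), (x : ℂ) ^ (s - 1) * g x := by
  rw [intervalIntegral.integral_of_le (by norm_num), halfMellin, mellin]
  rw [← integral_indicator measurableSet_Ioi, ← integral_indicator measurableSet_Ioc]
  congr 1 with x
  by_cases hx : x ∈ Set.Ioc (0 : ℝ) (1 / 2)
  · have h0 : x ∈ Set.Ioi (0 : ℝ) := hx.1
    rw [Set.indicator_of_mem h0, Set.indicator_of_mem hx, Set.indicator_of_mem hx, smul_eq_mul]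
  · rw [Set.indicator_of_notMem hx, Set.indicator_apply_eq_zero]
    intro _
    rw [Set.indicator_of_notMem hx, smul_zero]

lemma halfMellin_eq_of_re_pos {g : ℝ → ℂ} (hg : AnalyticOnNhd ℝ g (Set.Icc 0 (1 / 2))) {s : ℂ}
    (hs : 0 < s.re) :
    halfMellin g s = (g (1 / 2) * (1 / 2 : ℂ) ^ s - halfMellin (deriv g) (s + 1)) / s := by
  have hs0 : s ≠ 0 := by rintro rfl; simp at hs
  have hI : Set.uIcc (0 : ℝ) (1 / 2) = Set.Icc 0 (1 / 2) := Set.uIcc_of_le (by norm_num)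
  have hcpow : ContinuousOn (fun x : ℝ => (x : ℂ) ^ s) (Set.Icc 0 (1 / 2)) := fun x _ =>
    (Complex.continuousAt_ofReal_cpow_const x s (Or.inl hs)).continuousWithinAt
  have key := intervalIntegral.integral_mul_deriv_eq_deriv_mul_of_hasDerivAt
    (a := (0 : ℝ)) (b := 1 / 2) (u := g) (v := fun x : ℝ => (x : ℂ) ^ s / s) (u' := deriv g)
    (v' := fun x : ℝ => (x : ℂ) ^ (s - 1))
    (by rw [hI]; exact hg.continuousOn)
    (by rw [hI]; exact hcpow.div_const s)
    (fun x hx => by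
      rw [min_eq_left (by norm_num), max_eq_right (by norm_num)] at hx
      exact (hg x ⟨hx.1.le, hx.2.le⟩).differentiableAt.hasDerivAt)
    (fun x hx => by
      rw [min_eq_left (by norm_num), max_eq_right (by norm_num)] at hx
      have := (hasDerivAt_ofReal_cpow_const (x := x) hx.1.ne' hs0).div_const s
      rwa [mul_div_cancel_left₀ _ hs0] at this)
    (by
      apply ContinuousOn.intervalIntegrable
      rw [hI]; exact hg.deriv.continuousOn)
    (intervalIntegral.intervalIntegrable_cpow' (by simpa using hs))
  rw [halfMellin_eq_intervalIntegral, halfMellin_eq_intervalIntegral]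
  have e1 : (∫ x in (0 : ℝ)..(1 / 2), (x : ℂ) ^ (s - 1) * g x)
      = ∫ x in (0 : ℝ)..(1 / 2), g x * (x : ℂ) ^ (s - 1) := by
    simp_rw [mul_comm]
  have e2 : (∫ x in (0 : ℝ)..(1 / 2), deriv g x * ((x : ℂ) ^ s / s))
      = (∫ x in (0 : ℝ)..(1 / 2), (x : ℂ) ^ (s + 1 - 1) * deriv g x) / s := by
    rw [← intervalIntegral.integral_div]
    congr 1 with x
    rw [add_sub_cancel_right]; ring
  rw [e1, key, e2]
  simp [Complex.zero_cpow hs0]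
  ring

/-- The `K`-fold integration by parts of `halfMellin g`, meaningful for `-K < re s`. -/
noncomputable def halfMellinParts : ℕ → (ℝ → ℂ) → ℂ → ℂ
  | 0, g, s => halfMellin g s
  | K + 1, g, s => (g (1 / 2) * (1 / 2 : ℂ) ^ s - halfMellinParts K (deriv g) (s + 1)) / s

lemma halfMellinParts_succ {g : ℝ → ℂ} (hg : AnalyticOnNhd ℝ g (Set.Icc 0 (1 / 2))) {K : ℕ} {s : ℂ}
    (hs : -(K : ℝ) < s.re) : halfMellinParts (K + 1) g s = halfMellinParts K g s := by
  induction K generalizing g s with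
  | zero => exact (halfMellin_eq_of_re_pos hg (by simpa using hs)).symm
  | succ K ih =>
    rw [halfMellinParts, ih hg.deriv (by push_cast at hs; simp; linarith)]
    rfl

lemma halfMellinParts_eq {g : ℝ → ℂ} (hg : AnalyticOnNhd ℝ g (Set.Icc 0 (1 / 2))) {K L : ℕ} {s : ℂ}
    (hK : -(K : ℝ) < s.re) (hKL : K ≤ L) : halfMellinParts L g s = halfMellinParts K g s := by
  induction L, hKL using Nat.le_induction with
  | base => rfl
  | succ L hL ih =>
    rw [halfMellinParts_succ hg, ih]
    have : (K : ℝ) ≤ L := by exact_mod_cast hL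
    linarith

/-- The meromorphic continuation of `halfMellin g` for `g` analytic on `[0, 1/2]`. -/
noncomputable def halfMellinCont (g : ℝ → ℂ) (s : ℂ) : ℂ :=
  halfMellinParts (⌊-s.re⌋₊ + 1) g s

lemma halfMellinCont_eq {g : ℝ → ℂ} (hg : AnalyticOnNhd ℝ g (Set.Icc 0 (1 / 2))) {K : ℕ} {s : ℂ}
    (hK : -(K : ℝ) < s.re) : halfMellinCont g s = halfMellinParts K g s := by
  have h1 : -((⌊-s.re⌋₊ + 1 : ℕ) : ℝ) < s.re := by
    have := Nat.lt_floor_add_one (-s.re)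
    push_cast
    linarith
  rcases le_total K (⌊-s.re⌋₊ + 1) with h | h
  · exact halfMellinParts_eq hg hK h
  · exact (halfMellinParts_eq hg h1 h).symm

lemma halfMellinCont_eq_div {g : ℝ → ℂ} (hg : AnalyticOnNhd ℝ g (Set.Icc 0 (1 / 2))) (s : ℂ) :
    halfMellinCont g s
      = (g (1 / 2) * (1 / 2 : ℂ) ^ s - halfMellinCont (deriv g) (s + 1)) / s := by
  obtain ⟨K, hK⟩ := exists_nat_gt (-s.re)
  rw [halfMellinCont_eq hg (K := K + 1) (by push_cast; linarith), halfMellinParts,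
    halfMellinCont_eq hg.deriv (K := K) (by simp; linarith)]

lemma halfMellinCont_eq_halfMellin {g : ℝ → ℂ} (hg : AnalyticOnNhd ℝ g (Set.Icc 0 (1 / 2)))
    {s : ℂ} (hs : 0 < s.re) : halfMellinCont g s = halfMellin g s :=
  halfMellinCont_eq (K := 0) hg (by simpa using hs)

lemma halfMellinCont_eventuallyEq {g : ℝ → ℂ} (hg : AnalyticOnNhd ℝ g (Set.Icc 0 (1 / 2)))
    {s : ℂ} (hs : 0 < s.re) : halfMellinCont g =ᶠ[𝓝 s] halfMellin g := by
  filter_upwards [(isOpen_lt continuous_const Complex.continuous_re).mem_nhds hs] with z hz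
  exact halfMellinCont_eq_halfMellin hg hz

lemma halfMellinCont_analyticAt {g : ℝ → ℂ} (hg : AnalyticOnNhd ℝ g (Set.Icc 0 (1 / 2)))
    {s : ℂ} (hs : 0 < s.re) : AnalyticAt ℂ (halfMellinCont g) s := by
  rw [analyticAt_congr (halfMellinCont_eventuallyEq hg hs)]
  refine DifferentiableOn.analyticAt (s := {z : ℂ | 0 < z.re}) (fun z hz => ?_)
    ((isOpen_lt continuous_const Complex.continuous_re).mem_nhds hs)
  exact (halfMellin_hasDerivAt hg.continuousOn hz).2.differentiableAt.differentiableWithinAt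

lemma half_cpow_analyticAt (s : ℂ) : AnalyticAt ℂ (fun z : ℂ => (1 / 2 : ℂ) ^ z) s := by
  refine analyticAt_const.cpow analyticAt_id ?_
  simp [Complex.slitPlane]

lemma halfMellinCont_meromorphicAt {g : ℝ → ℂ} (hg : AnalyticOnNhd ℝ g (Set.Icc 0 (1 / 2)))
    (s : ℂ) : MeromorphicAt (halfMellinCont g) s := by
  obtain ⟨K, hK⟩ := exists_nat_gt (-s.re)
  induction K generalizing g s with
  | zero => exact (halfMellinCont_analyticAt hg (by simpa using hK)).meromorphicAt
  | succ K ih =>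
    have h1 : MeromorphicAt (fun z => halfMellinCont (deriv g) (z + 1)) s :=
      MeromorphicAt.comp_analyticAt (g := fun z : ℂ => z + 1)
        (ih hg.deriv (s + 1) (by push_cast at hK; simp; linarith)) (by fun_prop)
    rw [funext (halfMellinCont_eq_div hg)]
    exact ((analyticAt_const.mul (half_cpow_analyticAt s)).meromorphicAt.sub h1).div
      analyticAt_id.meromorphicAt

/-- The poles of `halfMellinCont g` are at most simple. -/
lemma halfMellinCont_tendsto_sq_mul {g : ℝ → ℂ} (hg : AnalyticOnNhd ℝ g (Set.Icc 0 (1 / 2)))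
    (j : ℕ) :
    Tendsto (fun s : ℂ => (s + j) ^ 2 * halfMellinCont g s) (𝓝[≠] (-(j : ℂ))) (𝓝 0) := by
  induction j generalizing g with
  | zero =>
    have hA : ContinuousAt (fun s : ℂ => s * (g (1 / 2) * (1 / 2 : ℂ) ^ s
        - halfMellinCont (deriv g) (s + 1))) 0 := by
      have h1 : ContinuousAt (fun s => halfMellinCont (deriv g) (s + 1)) (0 : ℂ) :=
        ContinuousAt.comp (g := halfMellinCont (deriv g)) (f := fun s : ℂ => s + 1)
          (halfMellinCont_analyticAt hg.deriv (by simp)).continuousAt (by fun_prop)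
      exact continuousAt_id.mul ((continuousAt_const.mul
        (half_cpow_analyticAt 0).continuousAt).sub h1)
    have := hA.tendsto.mono_left (nhdsWithin_le_nhds (s := {0}ᶜ))
    simp only [zero_mul] at this
    simp only [Nat.cast_zero, neg_zero, add_zero]
    refine this.congr' ?_
    filter_upwards [self_mem_nhdsWithin] with s hs
    rw [halfMellinCont_eq_div hg]
    have : s ≠ 0 := hs
    field_simp
  | succ j ih =>
    have hne : -((j + 1 : ℕ) : ℂ) ≠ 0 := by
      rw [neg_ne_zero]; exact_mod_cast Nat.succ_ne_zero j
    have h1 : Tendsto (fun s : ℂ => s + 1) (𝓝[≠] (-((j + 1 : ℕ) : ℂ))) (𝓝[≠] (-(j : ℂ))) := by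
      refine tendsto_nhdsWithin_iff.2 ⟨?_, ?_⟩
      · have : Tendsto (fun s : ℂ => s + 1) (𝓝 (-((j + 1 : ℕ) : ℂ))) (𝓝 (-((j + 1 : ℕ) : ℂ) + 1)) :=
          (continuous_id.add continuous_const).tendsto _
        have e : -((j + 1 : ℕ) : ℂ) + 1 = -(j : ℂ) := by push_cast; ring
        rw [e] at this
        exact this.mono_left nhdsWithin_le_nhds
      · filter_upwards [self_mem_nhdsWithin] with s hs h
        apply hs
        simp only [Set.mem_singleton_iff] at h ⊢
        push_cast
        linear_combination h
    have h2 := (ih hg.deriv).comp h1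
    have h3 : Tendsto (fun s : ℂ => (s + (j + 1 : ℕ)) ^ 2 * (g (1 / 2) * (1 / 2 : ℂ) ^ s))
        (𝓝[≠] (-((j + 1 : ℕ) : ℂ))) (𝓝 0) := by
      have : ContinuousAt (fun s : ℂ => (s + (j + 1 : ℕ)) ^ 2 * (g (1 / 2) * (1 / 2 : ℂ) ^ s))
          (-((j + 1 : ℕ) : ℂ)) :=
        ContinuousAt.mul (by fun_prop)
          (continuousAt_const.mul (half_cpow_analyticAt _).continuousAt)
      have := this.tendsto.mono_left (nhdsWithin_le_nhds (s := {-((j + 1 : ℕ) : ℂ)}ᶜ))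
      simpa using this
    have h4 := (h3.sub h2).div (tendsto_id.mono_left nhdsWithin_le_nhds) hne
    simp only [sub_zero, zero_div] at h4
    refine h4.congr fun s => ?_
    rw [halfMellinCont_eq_div hg]
    simp only [Pi.div_apply, Function.comp, id]
    push_cast
    ring

/-- The double pole at `0` of the derivative of `halfMellinCont g`. -/
lemma halfMellinCont_tendsto_sq_mul_deriv {g : ℝ → ℂ}
    (hg : AnalyticOnNhd ℝ g (Set.Icc 0 (1 / 2))) :
    Tendsto (fun s : ℂ => s ^ 2 * deriv (halfMellinCont g) s) (𝓝[≠] 0) (𝓝 (-g 0)) := by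
  set H : ℂ → ℂ := fun s => g (1 / 2) * (1 / 2 : ℂ) ^ s - halfMellinCont (deriv g) (s + 1) with hH
  have hHan : AnalyticAt ℂ H 0 := by
    have h1 : AnalyticAt ℂ (fun s => halfMellinCont (deriv g) (s + 1)) (0 : ℂ) :=
      AnalyticAt.fun_comp (g := halfMellinCont (deriv g)) (f := fun s : ℂ => s + 1)
        (halfMellinCont_analyticAt hg.deriv (by simp)) (by fun_prop)
    exact (analyticAt_const.mul (half_cpow_analyticAt 0)).sub h1
  have hH0 : H 0 = g 0 := by
    have h1 : ∫ x in (0 : ℝ)..(1 / 2), deriv g x = g (1 / 2) - g 0 := by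
      have hI : Set.uIcc (0 : ℝ) (1 / 2) = Set.Icc 0 (1 / 2) := Set.uIcc_of_le (by norm_num)
      refine intervalIntegral.integral_deriv_eq_sub ?_ ?_
      · rw [hI]; exact fun x hx => (hg x hx).differentiableAt
      · apply ContinuousOn.intervalIntegrable
        rw [hI]; exact hg.deriv.continuousOn
    rw [hH]
    simp only [Complex.cpow_zero, mul_one, zero_add]
    rw [halfMellinCont_eq_halfMellin hg.deriv (by simp), halfMellin_eq_intervalIntegral]
    simp only [sub_self, Complex.cpow_zero, one_mul, h1]
    ring
  have hlim : Tendsto (fun s => s * deriv H s - H s) (𝓝[≠] 0) (𝓝 (-g 0)) := by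
    have : ContinuousAt (fun s => s * deriv H s - H s) 0 :=
      (continuousAt_id.mul hHan.deriv.continuousAt).sub hHan.continuousAt
    have := this.tendsto.mono_left (nhdsWithin_le_nhds (s := {0}ᶜ))
    simpa [hH0] using this
  refine hlim.congr' ?_
  filter_upwards [self_mem_nhdsWithin, nhdsWithin_le_nhds hHan.eventually_analyticAt] with s hs hs'
  have hs0 : s ≠ 0 := hs
  rw [funext (halfMellinCont_eq_div hg)]
  have := (hs'.differentiableAt.hasDerivAt.div (hasDerivAt_id s) hs0).deriv
  simp only [id, mul_one] at this
  change _ = s ^ 2 * deriv (H / id) s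
  rw [this]
  field_simp

/-- The Mellin transform of `f` restricted to `(1/2, 1]`. -/
noncomputable def tailMellin (f : ℝ → ℂ) : ℂ → ℂ :=
  mellin ((Set.Ioc (1 / 2) 1).indicator f)

lemma tailMellin_differentiableAt {f : ℝ → ℂ} (hf : ContinuousOn f (Set.Icc 0 1)) (s : ℂ) :
    MellinConvergent ((Set.Ioc (1 / 2) 1).indicator f) s ∧ DifferentiableAt ℂ (tailMellin f) s := by
  have h1 : IntegrableOn f (Set.Ioc (1 / 2) 1) :=
    (hf.integrableOn_compact isCompact_Icc).mono_set
      (fun x hx => ⟨by linarith [hx.1], hx.2⟩)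
  have h2 : LocallyIntegrableOn ((Set.Ioc (1 / 2) 1).indicator f) (Set.Ioi 0) :=
    (h1.integrable_indicator measurableSet_Ioc).locallyIntegrable.locallyIntegrableOn _
  have h3 : (Set.Ioc (1 / 2) 1).indicator f =O[atTop] (fun x : ℝ => x ^ (-(s.re + 1))) := by
    refine EventuallyEq.trans_isBigO ?_ (Asymptotics.isBigO_zero _ _)
    filter_upwards [eventually_gt_atTop 1] with x hx
    exact Set.indicator_of_notMem (fun h => absurd h.2 (not_le.2 hx)) _
  have h4 : (Set.Ioc (1 / 2) 1).indicator f =O[𝓝[>] 0] (fun x : ℝ => x ^ (-(s.re - 1))) := by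
    refine EventuallyEq.trans_isBigO ?_ (Asymptotics.isBigO_zero _ _)
    filter_upwards [Ioc_mem_nhdsGT (show (0 : ℝ) < 1 / 2 by norm_num)] with x hx
    exact Set.indicator_of_notMem (fun h => absurd h.1 (not_lt.2 hx.2)) _
  exact ⟨mellinConvergent_of_isBigO_rpow h2 h3 (by linarith) h4 (by linarith),
    mellin_differentiableAt_of_isBigO_rpow h2 h3 (by linarith) h4 (by linarith)⟩

/-- A function on `(0, 1]` with expansion `a + x ^ N b log x + x ^ (2N) c (log x) ^ 2` near `0` has
a meromorphic Mellin transform, whose double pole at `-(N + 1)` is governed by `b 0`. -/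
lemma exists_meromorphic_continuation {f a b c : ℝ → ℂ} {N : ℕ} (hN : 0 < N)
    (hf : ContinuousOn f (Set.Icc 0 1))
    (ha : AnalyticOnNhd ℝ a (Set.Icc 0 (1 / 2))) (hb : AnalyticOnNhd ℝ b (Set.Icc 0 (1 / 2)))
    (hc : AnalyticOnNhd ℝ c (Set.Icc 0 (1 / 2)))
    (hexp : ∀ x ∈ Set.Ioc (0 : ℝ) (1 / 2),
      f x = a x + x ^ N * log x * b x + x ^ (2 * N) * log x ^ 2 * c x) :
    ∃ M : ℂ → ℂ, (∀ s, MeromorphicAt M s) ∧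
      (∀ s : ℂ, -1 < s.re → M s = ∫ x in Set.Ioo (0 : ℝ) 1, (x : ℂ) ^ s * f x) ∧
      Tendsto (fun s : ℂ => (s + N + 1) ^ 2 * M s) (𝓝[≠] (-(N + 1 : ℂ))) (𝓝 (-b 0)) := by
  refine ⟨fun s => halfMellinCont a (s + 1) + deriv (halfMellinCont b) (s + 1 + N) +
    deriv (deriv (halfMellinCont c)) (s + 1 + (2 * N : ℕ)) + tailMellin f (s + 1), ?_, ?_, ?_⟩
  · intro s
    have hT : MeromorphicAt (fun z => tailMellin f (z + 1)) s := by
      have hd : Differentiable ℂ (fun z => tailMellin f (z + 1)) := fun z =>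
        DifferentiableAt.comp (g := tailMellin f) (f := fun z : ℂ => z + 1) z
          (tailMellin_differentiableAt hf (z + 1)).2 (by fun_prop)
      exact (hd.analyticAt s).meromorphicAt
    refine MeromorphicAt.add (MeromorphicAt.add (MeromorphicAt.add ?_ ?_) ?_) hT
    · exact MeromorphicAt.comp_analyticAt (g := fun z : ℂ => z + 1)
        (halfMellinCont_meromorphicAt ha _) (by fun_prop)
    · exact MeromorphicAt.comp_analyticAt (g := fun z : ℂ => z + 1 + N)
        (halfMellinCont_meromorphicAt hb _).deriv (by fun_prop)
    · exact MeromorphicAt.comp_analyticAt (g := fun z : ℂ => z + 1 + (2 * N : ℕ))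
        (halfMellinCont_meromorphicAt hc _).deriv.deriv (by fun_prop)
  · intro s hs
    have p1 : 0 < (s + 1).re := by simp; linarith
    have p2 : 0 < (s + 1 + N).re := by simp; linarith [Nat.cast_nonneg (α := ℝ) N]
    have p3 : 0 < (s + 1 + (2 * N : ℕ)).re := by
      simp; linarith [Nat.cast_nonneg (α := ℝ) N]
    have e2 : deriv (halfMellinCont b) (s + 1 + N)
        = mellin (fun t => log t • (Set.Ioc 0 (1 / 2)).indicator b t) (s + 1 + N) := by
      rw [(halfMellinCont_eventuallyEq hb p2).deriv_eq]
      exact (halfMellin_hasDerivAt hb.continuousOn p2).2.deriv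
    have e3 : deriv (deriv (halfMellinCont c)) (s + 1 + (2 * N : ℕ))
        = mellin (fun t => log t • (log t • (Set.Ioc 0 (1 / 2)).indicator c t))
          (s + 1 + (2 * N : ℕ)) := by
      have : deriv (halfMellinCont c) =ᶠ[𝓝 (s + 1 + (2 * N : ℕ))]
          mellin (fun t => log t • (Set.Ioc 0 (1 / 2)).indicator c t) := by
        filter_upwards [(isOpen_lt continuous_const Complex.continuous_re).mem_nhds p3] with z hz
        rw [(halfMellinCont_eventuallyEq hc hz).deriv_eq]
        exact (halfMellin_hasDerivAt hc.continuousOn hz).2.deriv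
      rw [this.deriv_eq]
      exact (halfMellin_hasDerivAt_log hc.continuousOn p3).2.deriv
    have c1 := halfMellin_convergent ha.continuousOn p1
    have c2 := MellinConvergent.cpow_smul.2 (halfMellin_hasDerivAt hb.continuousOn p2).1
    have c3 := MellinConvergent.cpow_smul.2 (halfMellin_hasDerivAt_log hc.continuousOn p3).1
    have c4 := (tailMellin_differentiableAt hf (s + 1)).1
    have h12 := hasMellin_add c1 c2
    have h123 := hasMellin_add h12.1 c3
    have h1234 := hasMellin_add h123.1 c4
    beta_reduce
    rw [halfMellinCont_eq_halfMellin ha p1, e2, e3, ← mellin_cpow_smul _ (s + 1) N,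
      ← mellin_cpow_smul _ (s + 1) (2 * N : ℕ),
      halfMellin, tailMellin, ← h12.2, ← h123.2, ← h1234.2, mellin,
      ← integral_Ioc_eq_integral_Ioo, ← integral_indicator measurableSet_Ioi,
      ← integral_indicator measurableSet_Ioc]
    congr 1 with x
    by_cases hx : x ∈ Set.Ioc (0 : ℝ) 1
    · rw [Set.indicator_of_mem (show x ∈ Set.Ioi (0 : ℝ) from hx.1), Set.indicator_of_mem hx]
      by_cases hx2 : x ≤ 1 / 2
      · have m1 : x ∈ Set.Ioc (0 : ℝ) (1 / 2) := ⟨hx.1, hx2⟩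
        have m2 : x ∉ Set.Ioc (1 / 2 : ℝ) 1 := fun h => absurd h.1 (not_lt.2 hx2)
        simp only [Set.indicator_of_mem m1, Set.indicator_of_notMem m2, hexp x m1, smul_eq_mul,
          Complex.real_smul, add_sub_cancel_right, Complex.cpow_natCast]
        ring
      · have m1 : x ∉ Set.Ioc (0 : ℝ) (1 / 2) := fun h => hx2 h.2
        have m2 : x ∈ Set.Ioc (1 / 2 : ℝ) 1 := ⟨not_le.1 hx2, hx.2⟩
        simp [-one_div, Set.indicator_of_notMem m1, Set.indicator_of_mem m2]
    · rw [Set.indicator_of_notMem hx, Set.indicator_apply_eq_zero]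
      intro h0
      have m1 : x ∉ Set.Ioc (0 : ℝ) (1 / 2) := fun h => hx ⟨h.1, h.2.trans (by norm_num)⟩
      have m2 : x ∉ Set.Ioc (1 / 2 : ℝ) 1 := fun h => hx ⟨h0, h.2⟩
      simp [-one_div, Set.indicator_of_notMem m1, Set.indicator_of_notMem m2]
  · have shift : ∀ w : ℂ, Tendsto (fun s : ℂ => s + w) (𝓝[≠] (-(N + 1 : ℂ)))
        (𝓝[≠] (-(N + 1 : ℂ) + w)) := fun w => by
      refine tendsto_nhdsWithin_iff.2
        ⟨((continuous_id.add continuous_const).tendsto _).mono_left nhdsWithin_le_nhds, ?_⟩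
      filter_upwards [self_mem_nhdsWithin] with s hs h
      exact hs (add_right_cancel h)
    have regular : ∀ g : ℂ → ℂ, ContinuousAt g (-(N + 1 : ℂ)) →
        Tendsto (fun s : ℂ => (s + N + 1) ^ 2 * g s) (𝓝[≠] (-(N + 1 : ℂ))) (𝓝 0) := fun g hg => by
      have h1 : ContinuousAt (fun s : ℂ => (s + N + 1) ^ 2 * g s) (-(N + 1 : ℂ)) :=
        ContinuousAt.mul (by fun_prop) hg
      have h2 := h1.tendsto.mono_left (nhdsWithin_le_nhds (s := {-(N + 1 : ℂ)}ᶜ))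
      have e : -(N + 1 : ℂ) + N + 1 = 0 := by ring
      simpa only [e, ne_eq, OfNat.ofNat_ne_zero, not_false_eq_true, zero_pow, zero_mul] using h2
    have t1 : Tendsto (fun s : ℂ => (s + N + 1) ^ 2 * halfMellinCont a (s + 1))
        (𝓝[≠] (-(N + 1 : ℂ))) (𝓝 0) := by
      have h := shift 1
      rw [show -(N + 1 : ℂ) + 1 = -N by ring] at h
      refine ((halfMellinCont_tendsto_sq_mul ha N).comp h).congr fun s => ?_
      simp only [Function.comp]
      ring
    have t2 : Tendsto (fun s : ℂ => (s + N + 1) ^ 2 * deriv (halfMellinCont b) (s + 1 + N))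
        (𝓝[≠] (-(N + 1 : ℂ))) (𝓝 (-b 0)) := by
      have h := shift (1 + N)
      rw [show -(N + 1 : ℂ) + (1 + N) = 0 by ring] at h
      refine ((halfMellinCont_tendsto_sq_mul_deriv hb).comp h).congr fun s => ?_
      simp only [Function.comp]
      rw [show s + (1 + N : ℂ) = s + 1 + N by ring]
      ring
    have t3 := regular (fun s => deriv (deriv (halfMellinCont c)) (s + 1 + (2 * N : ℕ))) (by
      refine ContinuousAt.comp (g := deriv (deriv (halfMellinCont c)))
        (f := fun s : ℂ => s + 1 + (2 * N : ℕ)) ?_ (by fun_prop)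
      refine (halfMellinCont_analyticAt hc ?_).deriv.deriv.continuousAt
      have : (0 : ℝ) < N := by exact_mod_cast hN
      simp
      linarith)
    have t4 := regular (fun s => tailMellin f (s + 1)) (
      ContinuousAt.comp (g := tailMellin f) (f := fun s : ℂ => s + 1)
        (tailMellin_differentiableAt hf _).2.continuousAt (by fun_prop))
    have := ((t1.add t2).add t3).add t4
    rw [zero_add, add_zero, add_zero] at this
    refine this.congr fun s => ?_
    ring

lemma poch_zero (x : ℝ) : poch x 0 = 1 := by simp [poch]

lemma poch_succ (x : ℝ) (k : ℕ) : poch x (k + 1) = poch x k * (x + k) := by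
  simp [poch, Finset.prod_range_succ]

lemma poch_one (x : ℝ) : poch x 1 = x := by simp [poch]

lemma poch_add (x : ℝ) (j k : ℕ) : poch x (j + k) = poch x j * poch (x + j) k := by
  simp [poch, Finset.prod_range_add, add_assoc]

lemma poch_ne_zero {x : ℝ} (hx : ∀ i : ℕ, x + i ≠ 0) (k : ℕ) : poch x k ≠ 0 :=
  Finset.prod_ne_zero_iff.2 fun i _ => hx i

lemma poch_pos {x : ℝ} (hx : 0 < x) (k : ℕ) : 0 < poch x k :=
  Finset.prod_pos fun i _ => by positivity

lemma poch_mul_Gamma {x : ℝ} (hx : ∀ i : ℕ, x + i ≠ 0) (k : ℕ) :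
    poch x k * Gamma x = Gamma (x + k) := by
  induction k with
  | zero => simp [poch_zero]
  | succ k ih =>
    rw [poch_succ, mul_right_comm, ih, Nat.cast_succ, ← add_assoc, Gamma_add_one (hx k), mul_comm]

lemma factorial_mul_poch (j k : ℕ) : (j.factorial : ℝ) * poch (j + 1) k = (j + k).factorial := by
  induction k with
  | zero => simp [poch_zero]
  | succ k ih =>
    rw [poch_succ, ← mul_assoc, ih, ← add_assoc, Nat.factorial_succ]
    push_cast
    ring

lemma ascPochhammer_eval_eq_poch (x : ℝ) (k : ℕ) : (ascPochhammer ℝ k).eval x = poch x k := by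
  induction k with
  | zero => simp [poch_zero]
  | succ k ih => rw [ascPochhammer_succ_eval, ih, poch_succ]

lemma poch_div_poch {b : ℝ} (hb : ∀ i : ℕ, b + i ≠ 0) (M k : ℕ) :
    poch b k / poch (b + M) k = poch b M / poch (b + k) M := by
  have h (l : ℕ) : ∀ i : ℕ, b + l + i ≠ 0 := fun i => by
    have := hb (l + i); push_cast at this; rwa [add_assoc]
  rw [div_eq_div_iff (poch_ne_zero (h M) k) (poch_ne_zero (h k) M), ← poch_add, ← poch_add,
    add_comm]

/-- The polynomial `k ↦ (μ + 1)_k / k!`. -/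
noncomputable def numPoly (μ : ℕ) : Polynomial ℝ :=
  Polynomial.C (1 / (μ.factorial : ℝ)) * (ascPochhammer ℝ μ).comp (Polynomial.X + Polynomial.C 1)

lemma numPoly_natDegree (μ : ℕ) : (numPoly μ).natDegree = μ := by
  rw [numPoly, Polynomial.natDegree_C_mul (by positivity), Polynomial.natDegree_comp,
    ascPochhammer_natDegree, Polynomial.natDegree_X_add_C, mul_one]

lemma numPoly_leadingCoeff (μ : ℕ) : (numPoly μ).leadingCoeff = 1 / (μ.factorial : ℝ) := by
  rw [numPoly, Polynomial.leadingCoeff_mul, Polynomial.leadingCoeff_C,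
    Polynomial.leadingCoeff_comp (by rw [Polynomial.natDegree_X_add_C]; exact one_ne_zero),
    (monic_ascPochhammer ℝ μ).leadingCoeff, Polynomial.leadingCoeff_X_add_C, one_pow, one_mul,
    mul_one]

lemma numPoly_eval (μ k : ℕ) : (numPoly μ).eval (k : ℝ) = poch (μ + 1) k / k.factorial := by
  rw [numPoly]
  simp only [Polynomial.eval_mul, Polynomial.eval_C, Polynomial.eval_comp, Polynomial.eval_add,
    Polynomial.eval_X, ascPochhammer_eval_eq_poch]
  have h1 := factorial_mul_poch μ k
  have h2 := factorial_mul_poch k μ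
  rw [add_comm k μ, ← h1] at h2
  have : (k.factorial : ℝ) ≠ 0 := by positivity
  have : (μ.factorial : ℝ) ≠ 0 := by positivity
  field_simp
  linarith

/-- A polynomial of degree `i` taking the value `j.choose i` at `-(b + j)`. -/
noncomputable def choosePoly (b : ℝ) (i : ℕ) : Polynomial ℝ :=
  Polynomial.C (1 / (i.factorial : ℝ)) *
    (descPochhammer ℝ i).comp (Polynomial.C (-1) * Polynomial.X + Polynomial.C (-b))

lemma choosePoly_natDegree (b : ℝ) (i : ℕ) : (choosePoly b i).natDegree = i := by
  rw [choosePoly, Polynomial.natDegree_C_mul (by positivity), Polynomial.natDegree_comp,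
    descPochhammer_natDegree, Polynomial.natDegree_linear (by norm_num), mul_one]

lemma choosePoly_leadingCoeff (b : ℝ) (i : ℕ) :
    (choosePoly b i).leadingCoeff = (-1) ^ i / (i.factorial : ℝ) := by
  rw [choosePoly, Polynomial.leadingCoeff_mul, Polynomial.leadingCoeff_C,
    Polynomial.leadingCoeff_comp (by rw [Polynomial.natDegree_linear (by norm_num)]; simp),
    (monic_descPochhammer ℝ i).leadingCoeff, Polynomial.leadingCoeff_linear (by norm_num),
    descPochhammer_natDegree]
  ring

lemma choosePoly_eval (b : ℝ) (i j : ℕ) :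
    (choosePoly b i).eval (-(b + j)) = (j.choose i : ℝ) := by
  rw [choosePoly]
  simp only [Polynomial.eval_mul, Polynomial.eval_C, Polynomial.eval_comp, Polynomial.eval_add,
    Polynomial.eval_X]
  rw [show -1 * -(b + j) + -b = (j : ℝ) by ring, descPochhammer_eval_eq_descFactorial,
    Nat.descFactorial_eq_factorial_mul_choose]
  have : (i.factorial : ℝ) ≠ 0 := by positivity
  push_cast
  field_simp

lemma injOn_node (b : ℝ) (s : Set ℕ) : Set.InjOn (fun j : ℕ => -(b + (j : ℝ))) s := by
  intro i _ j _ h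
  simpa using h

/-- Partial fractions with poles at `-b, -(b + 1), …, -(b + M - 1)`. -/
lemma eval_div_poch {b x : ℝ} {M : ℕ} {p : Polynomial ℝ} (hp : p.degree < M)
    (hx : ∀ i : ℕ, x + b + i ≠ 0) :
    p.eval x / poch (b + x) M = ∑ j ∈ Finset.range M,
      Lagrange.nodalWeight (Finset.range M) (fun j : ℕ => -(b + (j : ℝ))) j *
        p.eval (-(b + j)) / (x + b + j) := by
  have h1 := Lagrange.eq_interpolate (injOn_node b (Finset.range M)) (f := p) (by simpa using hp)
  have hn : ∀ i ∈ Finset.range M, x ≠ -(b + (i : ℝ)) := fun i _ h => hx i (by linarith)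
  have h2 := Lagrange.eval_interpolate_not_at_node (fun i : ℕ => p.eval (-(b + (i : ℝ)))) hn
  rw [← h1, Lagrange.eval_nodal] at h2
  have h3 : poch (b + x) M = ∏ i ∈ Finset.range M, (x - -(b + (i : ℝ))) :=
    Finset.prod_congr rfl fun i _ => by ring
  have h4 : poch (b + x) M ≠ 0 := poch_ne_zero (fun i => by rw [add_comm b]; exact hx i) M
  rw [h2, ← h3, mul_div_cancel_left₀ _ h4]
  refine Finset.sum_congr rfl fun j _ => ?_
  rw [sub_neg_eq_add, ← add_assoc]
  ring

lemma sum_nodalWeight_mul_eval {b : ℝ} {M : ℕ} {p : Polynomial ℝ} (hp : p.degree < M) :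
    ∑ j ∈ Finset.range M,
      Lagrange.nodalWeight (Finset.range M) (fun j : ℕ => -(b + (j : ℝ))) j * p.eval (-(b + j)) =
      p.coeff (M - 1) := by
  have h := Lagrange.coeff_eq_sum (injOn_node b (Finset.range M)) (P := p) (by simpa using hp)
  rw [Finset.card_range] at h
  rw [h]
  refine Finset.sum_congr rfl fun j _ => ?_
  rw [Lagrange.nodalWeight, Finset.prod_inv_distrib]
  ring

/-- The residues of the partial fraction expansion of the coefficients of the series. -/
noncomputable def coeffResidue (b : ℝ) (μ M j : ℕ) : ℝ :=
  Lagrange.nodalWeight (Finset.range M) (fun j : ℕ => -(b + (j : ℝ))) j *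
    (numPoly μ).eval (-(b + j))

lemma sum_coeffResidue_mul_choose (b : ℝ) {μ N i : ℕ} (hi : i ≤ N) :
    ∑ j ∈ Finset.range (μ + 1 + N), coeffResidue b μ (μ + 1 + N) j * (j.choose i : ℝ) =
      if i = N then (-1) ^ N / (μ.factorial * N.factorial : ℝ) else 0 := by
  have hne : numPoly μ ≠ 0 := by
    rw [← Polynomial.leadingCoeff_ne_zero, numPoly_leadingCoeff]; positivity
  have hne' : choosePoly b i ≠ 0 := by
    rw [← Polynomial.leadingCoeff_ne_zero, choosePoly_leadingCoeff]
    exact div_ne_zero (pow_ne_zero _ (by norm_num)) (by positivity)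
  have hdeg : (numPoly μ * choosePoly b i).natDegree = μ + i := by
    rw [Polynomial.natDegree_mul hne hne', numPoly_natDegree, choosePoly_natDegree]
  have h := sum_nodalWeight_mul_eval (b := b) (M := μ + 1 + N) (p := numPoly μ * choosePoly b i)
    (Polynomial.degree_le_natDegree.trans_lt (by rw [hdeg]; exact_mod_cast by omega))
  have h2 : ∑ j ∈ Finset.range (μ + 1 + N), coeffResidue b μ (μ + 1 + N) j * (j.choose i : ℝ) =
      (numPoly μ * choosePoly b i).coeff (μ + 1 + N - 1) := by
    rw [← h]
    refine Finset.sum_congr rfl fun j _ => ?_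
    rw [Polynomial.eval_mul, choosePoly_eval, coeffResidue, mul_assoc]
  rw [h2]
  split_ifs with hiN
  · subst hiN
    rw [show μ + 1 + i - 1 = (numPoly μ * choosePoly b i).natDegree by rw [hdeg]; omega,
      Polynomial.coeff_natDegree, Polynomial.leadingCoeff_mul, numPoly_leadingCoeff,
      choosePoly_leadingCoeff]
    field_simp
  · exact Polynomial.coeff_eq_zero_of_natDegree_lt (by rw [hdeg]; omega)

lemma exists_factor_residuePoly (b : ℝ) (μ N : ℕ) :
    ∃ E : Polynomial ℝ, E.eval 1 = (-1) ^ N / (μ.factorial * N.factorial : ℝ) ∧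
      ∀ y : ℝ, ∑ j ∈ Finset.range (μ + 1 + N), coeffResidue b μ (μ + 1 + N) j * y ^ j =
        (y - 1) ^ N * E.eval y := by
  set D : Polynomial ℝ := ∑ j ∈ Finset.range (μ + 1 + N),
    Polynomial.C (coeffResidue b μ (μ + 1 + N) j) * Polynomial.X ^ j with hD
  have hcoeff (i : ℕ) : (D.comp (Polynomial.X + Polynomial.C 1)).coeff i =
      ∑ j ∈ Finset.range (μ + 1 + N), coeffResidue b μ (μ + 1 + N) j * (j.choose i : ℝ) := by
    rw [hD, Polynomial.sum_comp, Polynomial.finsetSum_coeff]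
    refine Finset.sum_congr rfl fun j _ => ?_
    simp only [Polynomial.mul_comp, Polynomial.C_comp, Polynomial.pow_comp, Polynomial.X_comp,
      Polynomial.coeff_C_mul, Polynomial.C_1, Polynomial.coeff_X_add_one_pow]
  obtain ⟨E, hE⟩ : (Polynomial.X - Polynomial.C 1) ^ N ∣ D := by
    rw [Polynomial.X_sub_C_pow_dvd_iff, Polynomial.X_pow_dvd_iff]
    intro i hi
    rw [hcoeff, sum_coeffResidue_mul_choose b hi.le, if_neg hi.ne]
  refine ⟨E, ?_, fun y => ?_⟩
  · have h := hcoeff N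
    rw [sum_coeffResidue_mul_choose b le_rfl, if_pos rfl, hE] at h
    rw [← h, Polynomial.mul_comp, Polynomial.pow_comp]
    simp [Polynomial.coeff_zero_eq_eval_zero, Polynomial.eval_comp, Polynomial.coeff_X_pow_mul']
  · have h := congrArg (Polynomial.eval y) hE
    simpa [hD, Polynomial.eval_finsetSum] using h

lemma analyticAt_rpow_const {x : ℝ} (hx : 0 < x) (r : ℝ) :
    AnalyticAt ℝ (fun t : ℝ => t ^ r) x :=
  (Real.contDiffAt_rpow_const_of_ne hx.ne').analyticAt

/-- The sum of `t ^ k / (k + h)`, for `h` a half-integer, up to its logarithmic singularity. -/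
lemma exists_analytic_hasSum_pow_div (z : ℤ) :
    ∃ α : ℝ → ℝ, AnalyticOnNhd ℝ α (Set.Ioi 0) ∧ ∀ t ∈ Set.Ioo (0:ℝ) 1,
      HasSum (fun k : ℕ => t ^ k / (k + (z + 1 / 2 : ℝ)))
        (α t - t ^ (-(z + 1 / 2 : ℝ)) * log (1 - t)) := by
  have hne (z : ℤ) : (z + 1 / 2 : ℝ) ≠ 0 := fun h => by
    have h' : ((2 * z + 1 : ℤ) : ℝ) = 0 := by push_cast; linarith
    have := Int.cast_eq_zero.1 h'
    omega
  induction z using Int.induction_on with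
  | zero =>
    refine ⟨fun t => 2 * t ^ (-(1 / 2) : ℝ) * log (1 + t ^ (1 / 2 : ℝ)), fun t ht => ?_,
      fun t ht => ?_⟩
    · have ht' : (0:ℝ) < t := ht
      have h1 : 0 < 1 + t ^ (1 / 2 : ℝ) := by positivity
      exact (analyticAt_const.mul (analyticAt_rpow_const ht' _)).mul
        ((analyticAt_const.add (analyticAt_rpow_const ht' _)).log h1)
    · obtain ⟨h0, h1⟩ := ht
      have hs0 : 0 < √t := Real.sqrt_pos.2 h0
      have hs1 : √t < 1 := by rw [Real.sqrt_lt' one_pos]; simpa using h1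
      have hsq : √t * √t = t := Real.mul_self_sqrt h0.le
      have h := (Real.hasSum_log_sub_log_of_abs_lt_one (x := √t)
        (by rwa [abs_of_pos hs0])).mul_left (√t)⁻¹
      have hr : t ^ (-(1 / 2) : ℝ) = (√t)⁻¹ := by rw [Real.rpow_neg h0.le, Real.sqrt_eq_rpow]
      have hl : log (1 - t) = log (1 + √t) + log (1 - √t) := by
        rw [← Real.log_mul (by linarith) (by linarith)]
        congr 1
        linarith
      convert h using 1
      · rfl
      · ext k
        have : (√t) ^ (2 * k + 1) = √t * t ^ k := by
          rw [pow_succ, pow_mul, pow_two, hsq]; ring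
        rw [this]
        have h3 : (k + 1 / 2 : ℝ) ≠ 0 := by positivity
        have h4 : (2 * k + 1 : ℝ) ≠ 0 := by positivity
        push_cast
        field_simp
        simp
      · simp only [Int.cast_zero, zero_add]
        rw [hr, hl, ← Real.sqrt_eq_rpow]
        ring
  | succ i ih =>
    obtain ⟨α, hα, h⟩ := ih
    have hi := hne i
    refine ⟨fun t => (α t - 1 / ((i:ℤ) + 1 / 2)) / t, fun t ht =>
      ((hα t ht).sub analyticAt_const).div analyticAt_id (ne_of_gt ht), fun t ht => ?_⟩
    have h0 := ht.1
    have h1 := ((hasSum_nat_add_iff' 1).2 (h t ht)).mul_right t⁻¹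
    convert h1 using 1
    · rfl
    · ext k
      push_cast
      rw [pow_succ, mul_div_right_comm, mul_assoc, mul_inv_cancel₀ h0.ne', mul_one]
      ring_nf
    · have h2 : t ^ (-(((i:ℤ) + 1 : ℤ) + 1 / 2 : ℝ)) = t ^ (-((i:ℤ) + 1 / 2 : ℝ)) * t⁻¹ := by
        rw [← Real.rpow_neg_one t, ← Real.rpow_add h0]
        congr 1
        push_cast
        ring
      rw [h2]
      simp only [Finset.sum_range_one, Nat.cast_zero, pow_zero, zero_add]
      ring
  | pred i ih =>
    obtain ⟨α, hα, h⟩ := ih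
    refine ⟨fun t => t * α t + 1 / ((-(i:ℤ) - 1 : ℤ) + 1 / 2), fun t ht =>
      (analyticAt_id.mul (hα t ht)).add analyticAt_const, fun t ht => ?_⟩
    have h0 := ht.1
    rw [← hasSum_nat_add_iff' 1]
    convert (h t ht).mul_left t using 1
    · rfl
    · ext k
      rw [pow_succ, mul_comm _ t, mul_div_assoc]
      push_cast
      ring_nf
    · have h2 : t ^ (-((-(i:ℤ) - 1 : ℤ) + 1 / 2 : ℝ)) = t * t ^ (-((-(i:ℤ) : ℤ) + 1 / 2 : ℝ)) := by
        nth_rw 2 [← Real.rpow_one t]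
        rw [← Real.rpow_add h0]
        congr 1
        push_cast
        ring
      rw [h2]
      simp only [Finset.sum_range_one, Nat.cast_zero, pow_zero, zero_add]
      ring

/-- The coefficients of the series defining `₂F₁(m, 1 - h; m + h; t)`. -/
noncomputable def hypCoeff (h : ℝ) (m k : ℕ) : ℝ :=
  poch m k * poch (1 - h) k / (poch (m + h) k * (Nat.factorial k))

lemma hypCoeff_eq {h : ℝ} {N : ℕ} (hN : (N : ℝ) = 2 * h - 1) (hh : ∀ i : ℕ, 1 - h + i ≠ 0)
    (μ k : ℕ) : hypCoeff h (μ + 1) k =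
      poch (1 - h) (μ + 1 + N) * ((numPoly μ).eval (k : ℝ) / poch (1 - h + k) (μ + 1 + N)) := by
  have h1 := poch_div_poch hh (μ + 1 + N) k
  have h2 : 1 - h + ((μ + 1 + N : ℕ) : ℝ) = ((μ + 1 : ℕ) : ℝ) + h := by push_cast; linarith
  rw [h2] at h1
  rw [hypCoeff, numPoly_eval, mul_div_left_comm, ← h1]
  push_cast
  ring

lemma tendsto_pow_mul_hypCoeff {h : ℝ} {N : ℕ} (hN : (N : ℝ) = 2 * h - 1)
    (hh : ∀ i : ℕ, 1 - h + i ≠ 0) (μ : ℕ) {e : ℕ} (he : e ≤ N) :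
    Tendsto (fun k : ℕ => (k : ℝ) ^ e * hypCoeff h (μ + 1) k) atTop (𝓝 0) := by
  have hnum : (Polynomial.X ^ e * numPoly μ).natDegree ≤ e + μ :=
    Polynomial.natDegree_mul_le.trans (by rw [Polynomial.natDegree_X_pow, numPoly_natDegree])
  have hden : ((ascPochhammer ℝ (μ + 1 + N)).comp
      (Polynomial.X + Polynomial.C (1 - h))).natDegree = μ + 1 + N := by
    rw [Polynomial.natDegree_comp, ascPochhammer_natDegree, Polynomial.natDegree_X_add_C, mul_one]
  have hdeg := Polynomial.degree_lt_degree (p := Polynomial.X ^ e * numPoly μ)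
    (q := (ascPochhammer ℝ (μ + 1 + N)).comp (Polynomial.X + Polynomial.C (1 - h)))
    (by omega)
  have h1 := ((Polynomial.div_tendsto_atTop_zero_of_degree_lt _ _ hdeg).comp
    tendsto_natCast_atTop_atTop).const_mul (poch (1 - h) (μ + 1 + N))
  rw [mul_zero] at h1
  refine h1.congr fun k => ?_
  rw [hypCoeff_eq hN hh]
  simp only [Function.comp_apply, Polynomial.eval_mul, Polynomial.eval_pow, Polynomial.eval_X,
    Polynomial.eval_comp, Polynomial.eval_add, Polynomial.eval_C, ascPochhammer_eval_eq_poch]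
  rw [add_comm (k : ℝ)]
  ring

lemma summable_hypCoeff {h : ℝ} {N : ℕ} (hN : (N : ℝ) = 2 * h - 1)
    (hh : ∀ i : ℕ, 1 - h + i ≠ 0) (hN2 : 2 ≤ N) (μ : ℕ) :
    Summable (hypCoeff h (μ + 1)) := by
  have h1 := ((tendsto_pow_mul_hypCoeff hN hh μ hN2).isBigO_one ℝ).mul
    (Asymptotics.isBigO_refl (fun k : ℕ => 1 / (k : ℝ) ^ 2) atTop)
  refine summable_of_isBigO_nat (Real.summable_one_div_nat_pow.2 one_lt_two)
    (h1.congr' ?_ (.of_forall fun k => one_mul _))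
  filter_upwards [eventually_gt_atTop 0] with k hk
  have : (k : ℝ) ≠ 0 := by positivity
  field_simp

lemma hypCoeff_succ_right {h : ℝ} (hpos : 0 < h) (m k : ℕ) :
    hypCoeff h m (k + 1) = hypCoeff h m k * ((m + k) * (1 - h + k) / ((m + h + k) * (k + 1))) := by
  have h1 : poch (m + h) k ≠ 0 := (poch_pos (by positivity) k).ne'
  have h2 : (m + h + k : ℝ) ≠ 0 := by positivity
  have h3 : (k.factorial : ℝ) ≠ 0 := by positivity
  rw [hypCoeff, hypCoeff, poch_succ, poch_succ, poch_succ, Nat.factorial_succ]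
  push_cast
  field_simp

lemma poch_add_one {x : ℝ} (hx : 0 < x) (k : ℕ) : poch (x + 1) k = poch x k * (x + k) / x := by
  rw [eq_div_iff hx.ne', ← poch_succ, add_comm k 1, poch_add, mul_comm, poch_succ, poch_zero]
  simp

lemma hypCoeff_succ_left {h : ℝ} (hpos : 0 < h) {m : ℕ} (hm : 0 < m) (k : ℕ) :
    hypCoeff h (m + 1) k = hypCoeff h m k * ((m + k) * (m + h) / (m * (m + h + k))) := by
  have h1 : poch (m + h) k ≠ 0 := (poch_pos (by positivity) k).ne'
  have h2 : (m + h + k : ℝ) ≠ 0 := by positivity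
  have h3 : (k.factorial : ℝ) ≠ 0 := by positivity
  have h4 : (m : ℝ) ≠ 0 := by positivity
  have h5 : (m + h : ℝ) ≠ 0 := by positivity
  rw [hypCoeff, hypCoeff, Nat.cast_succ, add_right_comm (m : ℝ) 1 h,
    poch_add_one (by positivity : (0:ℝ) < m), poch_add_one (by positivity : 0 < m + h)]
  field_simp

lemma hasSum_telescope {f U : ℕ → ℝ} {u : ℝ} (hf : Summable f) (hU : ∀ k, f k = U (k + 1) - U k)
    (hu : Tendsto U atTop (𝓝 u)) : HasSum f (u - U 0) := by
  have h1 := hf.hasSum.tendsto_sum_nat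
  have h2 : Tendsto (fun k => ∑ i ∈ Finset.range k, f i) atTop (𝓝 (u - U 0)) := by
    simp_rw [hU, Finset.sum_range_sub]
    exact hu.sub_const _
  rw [← tendsto_nhds_unique h1 h2]
  exact hf.hasSum

/-- Gauss's summation of `₂F₁(m, 1 - h; m + h; 1)`, normalised. -/
lemma hasSum_hypCoeff {h : ℝ} {N : ℕ} (hN : (N : ℝ) = 2 * h - 1)
    (hh : ∀ i : ℕ, 1 - h + i ≠ 0) (hN2 : 2 ≤ N) (μ : ℕ) :
    HasSum (fun k => poch (2 * h - 1) (μ + 1) / poch h (μ + 1) * hypCoeff h (μ + 1) k) 1 := by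
  have hN2' : (2:ℝ) ≤ N := by exact_mod_cast hN2
  have hpos : 0 < h := by linarith
  induction μ with
  | zero =>
    have hN1 : 2 * h - 1 ≠ 0 := by linarith
    have hs := (summable_hypCoeff hN hh hN2 0).mul_left
      (poch (2 * h - 1) (0 + 1) / poch h (0 + 1))
    have t0 := tendsto_pow_mul_hypCoeff hN hh 0 (show 0 ≤ N by omega)
    have t1 := tendsto_pow_mul_hypCoeff hN hh 0 (show 1 ≤ N by omega)
    have hc (k : ℕ) : poch (2 * h - 1) (0 + 1) / poch h (0 + 1) * hypCoeff h (0 + 1) k =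
        (2 * h - 1) * (poch (1 - h) k / poch h k) / (h + k) := by
      have h1 : poch h k ≠ 0 := (poch_pos hpos k).ne'
      have h2 : (h + k : ℝ) ≠ 0 := by positivity
      have h3 : (k.factorial : ℝ) ≠ 0 := by positivity
      have h4 := factorial_mul_poch 0 k
      simp only [Nat.factorial_zero, Nat.cast_one, Nat.cast_zero, zero_add, one_mul] at h4
      rw [hypCoeff, zero_add, Nat.cast_one, h4, add_comm 1 h, poch_add_one hpos, poch_one, poch_one]
      field_simp
    have key := hasSum_telescope (U := fun k => -(poch (1 - h) k / poch h k)) (u := 0) hs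
      (fun k => ?_) ?_
    · simpa [poch_zero] using key
    · rw [hc, poch_succ, poch_succ]
      have h1 : poch h k ≠ 0 := (poch_pos hpos k).ne'
      have h2 : (h + k : ℝ) ≠ 0 := by positivity
      field_simp
      ring
    · have t2 := ((t1.add (t0.const_mul h)).mul_const
        (-(poch (2 * h - 1) (0 + 1) / poch h (0 + 1)) / (2 * h - 1)))
      simp only [mul_zero, add_zero, zero_mul] at t2
      refine t2.congr fun k => ?_
      have h2 : (h + k : ℝ) ≠ 0 := by positivity
      have h5 : poch (1 - h) k / poch h k = (poch (2 * h - 1) (0 + 1) / poch h (0 + 1) *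
          hypCoeff h (0 + 1) k) * (h + k) / (2 * h - 1) := by
        rw [hc, div_mul_cancel₀ _ h2, mul_div_cancel_left₀ _ hN1]
      rw [h5]
      ring
  | succ μ ih =>
    have hκ : poch (2 * h - 1) (μ + 1 + 1) / poch h (μ + 1 + 1) =
        poch (2 * h - 1) (μ + 1) / poch h (μ + 1) *
          ((2 * h - 1 + (μ + 1 : ℕ)) / (h + (μ + 1 : ℕ))) := by
      rw [poch_succ _ (μ + 1), poch_succ _ (μ + 1), mul_div_mul_comm]
    set κ := poch (2 * h - 1) (μ + 1) / poch h (μ + 1)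
    have hs := ((summable_hypCoeff hN hh hN2 (μ + 1)).mul_left
      (poch (2 * h - 1) (μ + 1 + 1) / poch h (μ + 1 + 1))).sub ih.summable
    have t1 := (tendsto_pow_mul_hypCoeff hN hh μ (show 1 ≤ N by omega)).const_mul
      (-κ / ((μ + 1 : ℕ) : ℝ))
    rw [mul_zero] at t1
    have key := (hasSum_telescope hs (fun k => ?_) t1).add ih
    · simpa using key
    · have h2 : (((μ + 1 : ℕ) : ℝ) + h + k : ℝ) ≠ 0 := by positivity
      have h4 : ((μ + 1 : ℕ) : ℝ) ≠ 0 := by positivity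
      have h5 : (h + ((μ + 1 : ℕ) : ℝ)) ≠ 0 := by positivity
      rw [hκ, hypCoeff_succ_left hpos (Nat.succ_pos μ), hypCoeff_succ_right hpos (μ + 1)]
      push_cast at *
      field_simp
      ring

lemma exists_log_expansion {h : ℝ} {z : ℤ} (hz : 1 - h = z + 1 / 2) {N : ℕ}
    (hN : (N : ℝ) = 2 * h - 1) (hh : ∀ i : ℕ, 1 - h + i ≠ 0) (μ : ℕ) :
    ∃ A B : ℝ → ℝ, AnalyticOnNhd ℝ A (Set.Ioi 0) ∧ AnalyticOnNhd ℝ B (Set.Ioi 0) ∧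
      B 1 = -(poch (1 - h) (μ + 1 + N) * ((-1) ^ N / (μ.factorial * N.factorial))) ∧
      ∀ t ∈ Set.Ioo (0:ℝ) 1, HasSum (fun k => hypCoeff h (μ + 1) k * t ^ k)
        (A t + (1 - t) ^ N * log (1 - t) * B t) := by
  obtain ⟨E, hE1, hE⟩ := exists_factor_residuePoly (1 - h) μ N
  choose α hα hsum using exists_analytic_hasSum_pow_div
  set M := μ + 1 + N with hM
  set P := poch (1 - h) M
  refine ⟨fun t => P * ∑ j ∈ Finset.range M, coeffResidue (1 - h) μ M j * α (z + j) t,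
    fun t => -(P * (t ^ (-(1 - h)) * (t⁻¹ ^ N * E.eval t⁻¹))), fun t ht => ?_, fun t ht => ?_, ?_,
    fun t ht => ?_⟩
  · refine analyticAt_const.mul (Finset.analyticAt_fun_sum _ fun j _ => ?_)
    exact analyticAt_const.mul (hα _ t ht)
  · have hinv : AnalyticAt ℝ (fun t : ℝ => t⁻¹) t := analyticAt_inv (ne_of_gt ht)
    have h1 : AnalyticAt ℝ (fun t : ℝ => E.eval t⁻¹) t := by
      simpa using hinv.aeval_polynomial E
    exact (analyticAt_const.mul ((analyticAt_rpow_const ht _).mul ((hinv.pow N).mul h1))).neg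
  · simp [hE1]
  · obtain ⟨h0, h1⟩ := ht
    have hterm (j : ℕ) : HasSum (fun k : ℕ => coeffResidue (1 - h) μ M j *
        (t ^ k / (k + (1 - h) + j))) (coeffResidue (1 - h) μ M j *
          (α (z + j) t - t ^ (-(1 - h)) * t⁻¹ ^ j * log (1 - t))) := by
      have h2 := hsum (z + j) t ⟨h0, h1⟩
      have h3 : (((z + j : ℤ) : ℝ) + 1 / 2) = 1 - h + j := by rw [hz]; push_cast; ring
      rw [h3, neg_add, Real.rpow_add h0, Real.rpow_neg h0.le (j : ℝ), Real.rpow_natCast,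
        ← inv_pow] at h2
      simpa only [add_assoc] using h2.mul_left (coeffResidue (1 - h) μ M j)
    have h4 := (hasSum_sum (s := Finset.range M) fun j _ => hterm j).mul_left P
    have h5 : ∑ j ∈ Finset.range M, coeffResidue (1 - h) μ M j *
          (α (z + j) t - t ^ (-(1 - h)) * t⁻¹ ^ j * log (1 - t)) =
        ∑ j ∈ Finset.range M, coeffResidue (1 - h) μ M j * α (z + j) t -
          t ^ (-(1 - h)) * log (1 - t) * ((t⁻¹ - 1) ^ N * E.eval t⁻¹) := by
      rw [← hE, Finset.mul_sum, ← Finset.sum_sub_distrib]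
      exact Finset.sum_congr rfl fun j _ => by ring
    have h6 : (t⁻¹ - 1) ^ N = (1 - t) ^ N * t⁻¹ ^ N := by
      rw [← mul_pow]
      congr 1
      field_simp
    rw [h5, h6] at h4
    convert h4 using 1
    · rfl
    · ext k
      have hx : ∀ i : ℕ, (k : ℝ) + (1 - h) + i ≠ 0 := fun i => by
        have := hh (k + i)
        push_cast at this
        rwa [add_comm (k : ℝ), add_assoc]
      have hdeg : (numPoly μ).degree < M := Polynomial.degree_le_natDegree.trans_lt (by
        rw [numPoly_natDegree]; exact_mod_cast by omega)
      rw [hypCoeff_eq hN hh, eval_div_poch hdeg hx, mul_assoc, Finset.sum_mul]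
      congr 1
      refine Finset.sum_congr rfl fun j _ => ?_
      rw [coeffResidue]
      ring
    · ring

lemma tendsto_one_sub_pow_mul_log {N : ℕ} (hN : 0 < N) :
    Tendsto (fun t : ℝ => (1 - t) ^ N * log (1 - t)) (𝓝[<] 1) (𝓝 0) := by
  have h1 : Tendsto (fun t : ℝ => 1 - t) (𝓝[<] 1) (𝓝[>] 0) := by
    refine tendsto_nhdsWithin_iff.2 ⟨?_, ?_⟩
    · have : Tendsto (fun t : ℝ => 1 - t) (𝓝 1) (𝓝 (1 - 1)) :=
        tendsto_const_nhds.sub tendsto_id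
      rw [sub_self] at this
      exact this.mono_left nhdsWithin_le_nhds
    · filter_upwards [self_mem_nhdsWithin] with t ht
      exact sub_pos.2 (Set.mem_Iio.1 ht)
  have h2 := (tendsto_log_mul_rpow_nhdsGT_zero (show (0:ℝ) < N by exact_mod_cast hN)).comp h1
  refine h2.congr fun t => ?_
  simp [mul_comm]

/-- The expansion of `Sfun` at `t = 1` in odd dimension. -/
lemma exists_Sfun_log_expansion {q : ℕ} (hq : 0 < q) (μ : ℕ) :
    ∃ A B : ℝ → ℝ, AnalyticOnNhd ℝ A (Set.Ioi 0) ∧ AnalyticOnNhd ℝ B (Set.Ioi 0) ∧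
      A 1 = 1 ∧
      B 1 = -(poch (2 * q : ℝ) (μ + 1) / poch (q + 1 / 2) (μ + 1) *
        (poch (1 / 2 - q) (μ + 1 + 2 * q) / (μ.factorial * (2 * q).factorial))) ∧
      ContinuousOn (Sfun (2 * q + 1 : ℝ) (μ + 1)) (Set.Icc 0 1) ∧
      ∀ t ∈ Set.Ioo (0:ℝ) 1, Sfun (2 * q + 1 : ℝ) (μ + 1) t =
        A t + (1 - t) ^ (2 * q) * log (1 - t) * B t := by
  have hz : 1 - (q + 1 / 2 : ℝ) = ((-(q : ℤ) : ℤ) : ℝ) + 1 / 2 := by push_cast; ring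
  have hN : ((2 * q : ℕ) : ℝ) = 2 * (q + 1 / 2 : ℝ) - 1 := by push_cast; ring
  have hh (i : ℕ) : 1 - (q + 1 / 2 : ℝ) + i ≠ 0 := fun h => by
    have h' : ((1 + 2 * i : ℕ) : ℝ) = ((2 * q : ℕ) : ℝ) := by push_cast; linarith
    have := Nat.cast_injective h'
    omega
  have hN2 : 2 ≤ 2 * q := by omega
  obtain ⟨A, B, hA, hB, hB1, hsum⟩ := exists_log_expansion hz hN hh μ
  have hG := hasSum_hypCoeff hN hh hN2 μ
  rw [show 2 * (q + 1 / 2 : ℝ) - 1 = 2 * q by ring] at hG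
  set κ := poch (2 * q : ℝ) (μ + 1) / poch (q + 1 / 2) (μ + 1) with hκ
  have hS (t : ℝ) : Sfun (2 * q + 1 : ℝ) (μ + 1) t =
      κ * ∑' k, hypCoeff (q + 1 / 2) (μ + 1) k * t ^ k := by
    rw [Sfun, hκ, hyp2F1, show ((2 * q + 1 : ℝ) / 2) = q + 1 / 2 by ring,
      show (2 * q + 1 - 1 : ℝ) = 2 * q by ring]
    rfl
  have hcont : ContinuousOn (Sfun (2 * q + 1 : ℝ) (μ + 1)) (Set.Icc 0 1) := by
    have h1 : ContinuousOn (fun t : ℝ => ∑' k, hypCoeff (q + 1 / 2) (μ + 1) k * t ^ k)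
        (Set.Icc 0 1) := by
      refine continuousOn_tsum (fun k => by fun_prop) (summable_hypCoeff hN hh hN2 μ).norm
        fun k t ht => ?_
      rw [norm_mul, norm_pow, Real.norm_of_nonneg ht.1]
      exact mul_le_of_le_one_right (norm_nonneg _) (pow_le_one₀ ht.1 ht.2)
    exact (continuousOn_const.mul h1).congr fun t _ => hS t
  have hexp : ∀ t ∈ Set.Ioo (0:ℝ) 1, Sfun (2 * q + 1 : ℝ) (μ + 1) t =
      κ * A t + (1 - t) ^ (2 * q) * log (1 - t) * (κ * B t) := fun t ht => by
    rw [hS, (hsum t ht).tsum_eq]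
    ring
  refine ⟨fun t => κ * A t, fun t => κ * B t, fun t ht => analyticAt_const.mul (hA t ht),
    fun t ht => analyticAt_const.mul (hB t ht), ?_, ?_, hcont, hexp⟩
  · have h1 : Sfun (2 * q + 1 : ℝ) (μ + 1) 1 = 1 := by
      rw [hS, ← tsum_mul_left]
      simpa using hG.tsum_eq
    have h2 : Tendsto (Sfun (2 * q + 1 : ℝ) (μ + 1)) (𝓝[<] 1) (𝓝 1) := by
      have := (hcont 1 (by simp)).tendsto
      rw [h1] at this
      refine this.mono_left ?_
      rw [← nhdsWithin_Ioo_eq_nhdsLT (zero_lt_one (α := ℝ))]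
      exact nhdsWithin_mono _ Set.Ioo_subset_Icc_self
    have hA' : Tendsto A (𝓝[<] 1) (𝓝 (A 1)) :=
      (hA 1 (by simp)).continuousAt.tendsto.mono_left nhdsWithin_le_nhds
    have hB' : Tendsto B (𝓝[<] 1) (𝓝 (B 1)) :=
      (hB 1 (by simp)).continuousAt.tendsto.mono_left nhdsWithin_le_nhds
    have h3 := (hA'.const_mul κ).add
      ((tendsto_one_sub_pow_mul_log (show 0 < 2 * q by omega)).mul (hB'.const_mul κ))
    rw [zero_mul, add_zero] at h3
    refine tendsto_nhds_unique (h3.congr' ?_) h2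
    filter_upwards [Ioo_mem_nhdsLT (zero_lt_one (α := ℝ))] with t ht
    exact (hexp t ht).symm
  · beta_reduce
    rw [hB1, show 1 - (q + 1 / 2 : ℝ) = 1 / 2 - q by ring, (even_two_mul q).neg_one_pow]
    ring

lemma setIntegral_Ioo_one_sub (g : ℝ → ℝ) :
    ∫ x in Set.Ioo (0:ℝ) 1, g (1 - x) = ∫ x in Set.Ioo (0:ℝ) 1, g x := by
  rw [← integral_Ioc_eq_integral_Ioo, ← integral_Ioc_eq_integral_Ioo,
    ← intervalIntegral.integral_of_le zero_le_one, ← intervalIntegral.integral_of_le zero_le_one,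
    intervalIntegral.integral_comp_sub_left g 1]
  simp

lemma prod_range_cast_sub (N : ℕ) :
    ∏ i ∈ Finset.range N, (-(N + 1 : ℂ) + 1 + i) = (-1) ^ N * N.factorial := by
  rw [← Finset.prod_range_reflect]
  have h : ∀ i ∈ Finset.range N, (-(N + 1 : ℂ) + 1 + ((N - 1 - i : ℕ) : ℂ)) =
      -1 * ((i + 1 : ℕ) : ℂ) := fun i hi => by
    have := Finset.mem_range.1 hi
    rw [Nat.cast_sub (by omega), Nat.cast_sub (by omega)]
    push_cast
    ring
  rw [Finset.prod_congr rfl h, Finset.prod_mul_distrib, Finset.prod_const, Finset.card_range,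
    ← Nat.cast_prod, Finset.prod_range_add_one_eq_factorial]

lemma inv_Gamma_eq_prod_mul (s : ℂ) (k : ℕ) :
    (Complex.Gamma (s + 1))⁻¹ =
      (∏ i ∈ Finset.range k, (s + 1 + i)) * (Complex.Gamma (s + 1 + k))⁻¹ := by
  induction k with
  | zero => simp
  | succ k ih =>
    rw [ih, Complex.one_div_Gamma_eq_self_mul_one_div_Gamma_add_one, Finset.prod_range_succ]
    push_cast
    rw [add_assoc (s + 1), mul_assoc]

lemma tendsto_inv_Gamma_div (N : ℕ) :
    Tendsto (fun s : ℂ => (Complex.Gamma (s + 1))⁻¹ / (s + N + 1)) (𝓝[≠] (-(N + 1 : ℂ)))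
      (𝓝 ((-1) ^ N * N.factorial)) := by
  have hcont : Continuous fun s : ℂ =>
      (∏ i ∈ Finset.range N, (s + 1 + i)) * (Complex.Gamma (s + 1 + (N + 1 : ℕ)))⁻¹ := by
    have := Complex.differentiable_one_div_Gamma.continuous
    refine (continuous_finsetProd _ fun i _ => by fun_prop).mul (this.comp (by fun_prop))
  have h := (hcont.tendsto (-(N + 1 : ℂ))).mono_left (nhdsWithin_le_nhds (s := {-(N + 1 : ℂ)}ᶜ))
  rw [prod_range_cast_sub, show -(N + 1 : ℂ) + 1 + ((N + 1 : ℕ) : ℂ) = 1 by push_cast; ring,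
    Complex.Gamma_one, inv_one, mul_one] at h
  refine h.congr' ?_
  filter_upwards [self_mem_nhdsWithin] with s hs
  have hs' : s + N + 1 ≠ 0 := fun h0 => hs (by
    rw [Set.mem_singleton_iff, eq_neg_iff_add_eq_zero, ← h0]; ring)
  rw [inv_Gamma_eq_prod_mul s (N + 1), Finset.prod_range_succ, eq_div_iff hs']
  ring

lemma meromorphicAt_Gamma_add (c s : ℂ) : MeromorphicAt (fun s => Complex.Gamma (c + s)) s :=
  (MeromorphicOn.Gamma (c + s) (Set.mem_univ _)).comp_analyticAt (by fun_prop)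

lemma exists_continuation_integral {q : ℕ} (hq : 0 < q) (μ : ℕ) :
    ∃ M : ℂ → ℂ, (∀ s, MeromorphicAt M s) ∧
      (∀ s : ℝ, -1 < s → M s = ((∫ t in Set.Ioo (0:ℝ) 1, t ^ (((μ + 1 : ℕ) : ℝ) +
        (2 * q + 1 : ℝ) / 2 - 1) * (1 - t) ^ s * (Sfun (2 * q + 1 : ℝ) (μ + 1) t) ^ 2 : ℝ) : ℂ)) ∧
      Tendsto (fun s : ℂ => (s + (2 * q : ℕ) + 1) ^ 2 * M s) (𝓝[≠] (-((2 * q : ℕ) + 1 : ℂ)))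
        (𝓝 ((2 * (poch (2 * q : ℝ) (μ + 1) / poch (q + 1 / 2) (μ + 1) *
          (poch (1 / 2 - q) (μ + 1 + 2 * q) / (μ.factorial * (2 * q).factorial))) : ℝ) : ℂ)) := by
  obtain ⟨A, B, hA, hB, hA1, hB1, hS, hexp⟩ := exists_Sfun_log_expansion hq μ
  set S := Sfun (2 * q + 1 : ℝ) (μ + 1)
  set r : ℝ := ((μ + 1 : ℕ) : ℝ) + (2 * q + 1 : ℝ) / 2 - 1 with hr
  have hr0 : 0 ≤ r := by rw [hr]; push_cast; have : (0:ℝ) ≤ q := q.cast_nonneg; linarith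
  have hanalytic {u : ℝ → ℝ} (hu : AnalyticOnNhd ℝ u (Set.Ioi 0)) :
      AnalyticOnNhd ℝ (fun x : ℝ => ((u (1 - x) : ℝ) : ℂ)) (Set.Icc 0 (1 / 2)) := fun x hx =>
    (Complex.ofRealCLM.analyticAt _).fun_comp ((hu (1 - x) (by
      rw [Set.mem_Ioi]; linarith [hx.2])).fun_comp (analyticAt_const.sub analyticAt_id))
  have hpow : AnalyticOnNhd ℝ (fun t : ℝ => t ^ r) (Set.Ioi 0) :=
    fun t ht => analyticAt_rpow_const ht r
  have hcont : ContinuousOn (fun x => (((1 - x) ^ r * S (1 - x) ^ 2 : ℝ) : ℂ)) (Set.Icc 0 1) := by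
    refine Complex.continuous_ofReal.comp_continuousOn (ContinuousOn.mul ?_ (ContinuousOn.pow ?_ 2))
    · exact ContinuousOn.rpow_const (by fun_prop) fun _ _ => Or.inr hr0
    · exact hS.comp (by fun_prop) fun x hx => ⟨by linarith [hx.2], by linarith [hx.1]⟩
  obtain ⟨M, hM, hMint, hMlim⟩ := exists_meromorphic_continuation (N := 2 * q) (by omega)
    (a := fun x => (((1 - x) ^ r * A (1 - x) ^ 2 : ℝ) : ℂ))
    (b := fun x => (((1 - x) ^ r * (2 * (A (1 - x) * B (1 - x))) : ℝ) : ℂ))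
    (c := fun x => (((1 - x) ^ r * B (1 - x) ^ 2 : ℝ) : ℂ)) hcont
    (hanalytic (hpow.mul (hA.pow 2)))
    (hanalytic (hpow.mul (analyticOnNhd_const.mul (hA.mul hB))))
    (hanalytic (hpow.mul (hB.pow 2))) fun x hx => by
      have h1 := hexp (1 - x) ⟨by linarith [hx.2], by linarith [hx.1]⟩
      rw [sub_sub_cancel] at h1
      simp only [h1]
      push_cast
      ring
  refine ⟨M, hM, fun s hs => ?_, ?_⟩
  · rw [hMint s (by simpa using hs), ← setIntegral_Ioo_one_sub, ← integral_complex_ofReal]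
    refine setIntegral_congr_fun measurableSet_Ioo fun x hx => ?_
    simp only [sub_sub_cancel]
    rw [← Complex.ofReal_cpow hx.1.le]
    push_cast
    ring
  · convert hMlim using 2
    simp [hA1, hB1]

lemma residue_constant {q : ℕ} (μ : ℕ) :
    Real.Gamma (1 / 2 - q) / Real.Gamma (q + 1 / 2) * (2 * q).factorial *
      (2 * (poch (2 * q : ℝ) (μ + 1) / poch (q + 1 / 2) (μ + 1) *
        (poch (1 / 2 - q) (μ + 1 + 2 * q) / (μ.factorial * (2 * q).factorial)))) =
      2 * poch (2 * q : ℝ) (μ + 1) / Real.Gamma ((μ + 1 : ℕ) : ℝ) := by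
  have hpos : (0:ℝ) < q + 1 / 2 := by positivity
  have hb (i : ℕ) : (1 / 2 - q : ℝ) + i ≠ 0 := fun h => by
    have h' : ((1 + 2 * i : ℕ) : ℝ) = ((2 * q : ℕ) : ℝ) := by push_cast; linarith
    have := Nat.cast_injective h'
    omega
  have h1 := poch_mul_Gamma hb (μ + 1 + 2 * q)
  have h2 := poch_mul_Gamma (x := q + 1 / 2) (fun i => by positivity) (μ + 1)
  rw [show (1 / 2 - q : ℝ) + ((μ + 1 + 2 * q : ℕ) : ℝ) = q + 1 / 2 + ((μ + 1 : ℕ) : ℝ) by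
    push_cast; ring, ← h2] at h1
  have h3 : poch (q + 1 / 2 : ℝ) (μ + 1) ≠ 0 := (poch_pos hpos _).ne'
  have h4 : Real.Gamma (q + 1 / 2) ≠ 0 := (Real.Gamma_pos_of_pos hpos).ne'
  have h5 : (μ.factorial : ℝ) ≠ 0 := by positivity
  have h6 : ((2 * q).factorial : ℝ) ≠ 0 := by positivity
  rw [Nat.cast_succ, Real.Gamma_nat_eq_factorial]
  generalize poch (q + 1 / 2 : ℝ) (μ + 1) = p at h1 h3 ⊢
  generalize Real.Gamma (q + 1 / 2) = g at h1 h4 ⊢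
  generalize poch (1 / 2 - q : ℝ) (μ + 1 + 2 * q) = p' at h1 ⊢
  generalize Real.Gamma (1 / 2 - q) = g' at h1 ⊢
  field_simp
  linear_combination poch (2 * q : ℝ) (μ + 1) * h1

/-- for `n > 2` odd and `m > 0`, the meromorphic continuation of `I_m(s)`
has a simple pole at `s = -n` with residue `2(n-1)_m/Γ(m)`. -/
theorem Ifun_residue_odd (n : ℕ) (hn : 2 < n) (hne : Odd n) (m : ℕ) (hm : 0 < m) :
    ∃ G : ℂ → ℂ, MeromorphicOn G Set.univ ∧
      (∀ s : ℝ, -1 < s → G s = (Ifun n m s : ℂ)) ∧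
      Tendsto (fun s : ℂ => (s + n) * G s) (𝓝[≠] (-(n:ℂ)))
        (𝓝 ((2 * poch ((n:ℝ) - 1) m / Real.Gamma m : ℝ) : ℂ)) := by
  obtain ⟨q, rfl⟩ := hne
  obtain ⟨μ, rfl⟩ := Nat.exists_eq_succ_of_ne_zero hm.ne'
  obtain ⟨M, hM, hMint, hMlim⟩ := exists_continuation_integral (show 0 < q by omega) μ
  have hcast : ((2 * q + 1 : ℕ) : ℝ) = 2 * q + 1 := by push_cast; ring
  have hcast' : ((2 * q + 1 : ℕ) : ℂ) = (2 * q : ℕ) + 1 := by push_cast; ring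
  rw [hcast, hcast', add_sub_cancel_right]
  refine ⟨fun s => Complex.Gamma ((((2 * q + 1 : ℝ) / 2 + 1 : ℝ) : ℂ) + s) /
    (Real.Gamma ((2 * q + 1 : ℝ) / 2) : ℂ) * (Complex.Gamma (s + 1))⁻¹ * M s,
    fun s _ => ?_, fun s hs => ?_, ?_⟩
  · refine (((meromorphicAt_Gamma_add _ s).div (MeromorphicAt.const _ s)).mul ?_).mul (hM s)
    simpa only [add_comm] using (meromorphicAt_Gamma_add 1 s).fun_inv
  · beta_reduce
    rw [hMint s hs, Ifun, ← Complex.ofReal_add, Complex.Gamma_ofReal, ← Complex.ofReal_one,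
      ← Complex.ofReal_add, Complex.Gamma_ofReal, add_right_comm]
    push_cast
    ring
  · have hΓ : Tendsto (fun s : ℂ => Complex.Gamma ((((2 * q + 1 : ℝ) / 2 + 1 : ℝ) : ℂ) + s))
        (𝓝[≠] (-((2 * q : ℕ) + 1 : ℂ))) (𝓝 (Real.Gamma (1 / 2 - q) : ℂ)) := by
      have hval : (((2 * q + 1 : ℝ) / 2 + 1 : ℝ) : ℂ) + -((2 * q : ℕ) + 1 : ℂ) =
          ((1 / 2 - q : ℝ) : ℂ) := by push_cast; ring
      have hdiff : ContinuousAt Complex.Gamma ((1 / 2 - q : ℝ) : ℂ) := by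
        refine (Complex.differentiableAt_Gamma _ fun i h => ?_).continuousAt
        have h0 : (1 / 2 - q : ℝ) = -(i : ℝ) := by exact_mod_cast h
        have h' : ((1 + 2 * i : ℕ) : ℝ) = ((2 * q : ℕ) : ℝ) := by push_cast; linarith
        have := Nat.cast_injective h'
        omega
      rw [← Complex.Gamma_ofReal]
      rw [← hval] at hdiff ⊢
      exact (hdiff.tendsto.comp (tendsto_const_nhds.add tendsto_id)).mono_left nhdsWithin_le_nhds
    have hlim := (((hΓ.div_const (Real.Gamma ((2 * q + 1 : ℝ) / 2) : ℂ)).mul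
      (tendsto_inv_Gamma_div (2 * q))).mul hMlim)
    rw [(even_two_mul q).neg_one_pow, one_mul, show (2 * q + 1 : ℝ) / 2 = q + 1 / 2 by ring]
      at hlim
    rw [← residue_constant μ, show (2 * q + 1 : ℝ) / 2 = q + 1 / 2 by ring]
    convert hlim.congr' ?_ using 2
    · push_cast
      ring
    · filter_upwards [self_mem_nhdsWithin] with s hs
      have hs' : s + (2 * q : ℕ) + 1 ≠ 0 := fun h0 => hs (by
        rw [Set.mem_singleton_iff, eq_neg_iff_add_eq_zero, ← h0]; ring)
      rw [← add_assoc s]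
      field_simp
end

section
/- Suppose F is holomorphic near t = 1 with F(t) = Σ_{j≥0} F_j(1-t)^j there, continuous on [0,1], and k ≥ 0 is an integer. Then I_k(s) = ∫₀¹ F(t)(log(1/(1-t)))^k (1-t)^s dt, defined for Re s > -1, extends meromorphically to ℂ with poles of order k+1 at each s = -j-1, the principal part at s = -j-1 being k!·F_j/(s+j+1)^{k+1}. -/
open MeasureTheory Filter Topology Complex

/-- The function `x ↦ f x * (-log x) ^ k` cut off to `(0, 1]`. -/
noncomputable def logCutoff (f : ℝ → ℂ) (k : ℕ) : ℝ → ℂ :=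
  Set.indicator (Set.Ioc 0 1) fun x => f x * ((-Real.log x : ℝ) : ℂ) ^ k

theorem locallyIntegrableOn_logCutoff {f : ℝ → ℂ} (hf : ContinuousOn f (Set.Icc 0 1)) (k : ℕ) :
    LocallyIntegrableOn (logCutoff f k) (Set.Ioi 0) := by
  have hc : ContinuousOn (fun x : ℝ => f (min x 1) * ((-Real.log x : ℝ) : ℂ) ^ k)
      (Set.Ioi 0) := by
    refine ContinuousOn.mul (hf.comp (by fun_prop) fun x hx => ?_) ?_
    · exact ⟨le_min (le_of_lt hx) zero_le_one, min_le_right _ _⟩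
    · refine ContinuousOn.pow (continuous_ofReal.comp_continuousOn ?_) k
      exact (Real.continuousOn_log.mono fun x hx => (ne_of_gt hx : x ≠ 0)).neg
  have heq : logCutoff f k = Set.indicator (Set.Ioc 0 1)
      fun x : ℝ => f (min x 1) * ((-Real.log x : ℝ) : ℂ) ^ k :=
    Set.indicator_congr fun x hx => by rw [min_eq_left hx.2]
  intro x hx
  obtain ⟨t, ht, hi⟩ := hc.locallyIntegrableOn (μ := volume) measurableSet_Ioi x hx
  exact ⟨t, ht, heq ▸ hi.indicator measurableSet_Ioc⟩

theorem logCutoff_isBigO_atTop (f : ℝ → ℂ) (k : ℕ) (g : ℝ → ℝ) :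
    logCutoff f k =O[atTop] g := by
  have h : logCutoff f k =ᶠ[atTop] fun _ => 0 := by
    filter_upwards [eventually_gt_atTop 1] with x hx
    exact Set.indicator_of_notMem (fun h => absurd h.2 (not_le.2 hx)) _
  exact h.trans_isBigO (Asymptotics.isBigO_zero _ _)

theorem log_pow_isBigO_rpow_nhdsGT_zero (k : ℕ) {ε : ℝ} (hε : 0 < ε) :
    (fun x : ℝ => ((-Real.log x : ℝ) : ℂ) ^ k) =O[𝓝[>] 0] fun x : ℝ => x ^ (-ε) := by
  refine Asymptotics.IsBigO.trans (Asymptotics.isBigO_of_le _ fun x => ?_)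
    (isLittleO_abs_log_rpow_rpow_nhdsGT_zero (k : ℝ) (neg_lt_zero.2 hε)).isBigO
  simp [Real.rpow_natCast]

theorem logCutoff_isBigO_nhdsGT_zero {f : ℝ → ℂ} {n : ℕ}
    (hf : f =O[𝓝[>] 0] fun x : ℝ => x ^ n) (k : ℕ) {b : ℝ} (hb : -(n : ℝ) < b) :
    logCutoff f k =O[𝓝[>] 0] fun x : ℝ => x ^ (-b) := by
  have h := hf.mul (log_pow_isBigO_rpow_nhdsGT_zero k (ε := n + b) (by linarith))
  refine Asymptotics.IsBigO.trans (Asymptotics.isBigO_of_le _ fun x => ?_)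
    (h.congr' EventuallyEq.rfl ?_)
  · exact norm_indicator_le_norm_self _ _
  · filter_upwards [self_mem_nhdsWithin] with x hx
    rw [← Real.rpow_natCast, ← Real.rpow_add hx]
    congr 1
    ring

theorem mellinConvergent_logCutoff {f : ℝ → ℂ} (hc : ContinuousOn f (Set.Icc 0 1)) {n : ℕ}
    (hf : f =O[𝓝[>] 0] fun x : ℝ => x ^ n) (k : ℕ) {s : ℂ} (hs : -(n : ℝ) < s.re) :
    MellinConvergent (logCutoff f k) s := by
  obtain ⟨b, hb, hb'⟩ := exists_between hs
  exact mellinConvergent_of_isBigO_rpow (locallyIntegrableOn_logCutoff hc k)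
    (logCutoff_isBigO_atTop f k _) (lt_add_one _) (logCutoff_isBigO_nhdsGT_zero hf k hb) hb'

theorem hasDerivAt_mellin_logCutoff {f : ℝ → ℂ} (hc : ContinuousOn f (Set.Icc 0 1)) {n : ℕ}
    (hf : f =O[𝓝[>] 0] fun x : ℝ => x ^ n) (k : ℕ) {s : ℂ} (hs : -(n : ℝ) < s.re) :
    HasDerivAt (mellin (logCutoff f k)) (-mellin (logCutoff f (k + 1)) s) s := by
  obtain ⟨b, hb, hb'⟩ := exists_between hs
  have h := (mellin_hasDerivAt_of_isBigO_rpow (locallyIntegrableOn_logCutoff hc k)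
    (logCutoff_isBigO_atTop f k _) (lt_add_one _) (logCutoff_isBigO_nhdsGT_zero hf k hb) hb').2
  have heq : (fun t => Real.log t • logCutoff f k t) =
      fun t => (-1 : ℂ) • logCutoff f (k + 1) t := by
    ext t
    by_cases ht : t ∈ Set.Ioc (0 : ℝ) 1
    · simp only [logCutoff, Set.indicator_of_mem ht, real_smul, smul_eq_mul, ofReal_neg]
      ring
    · simp [logCutoff, Set.indicator_of_notMem ht]
  rw [heq, mellin_const_smul] at h
  simpa using h

theorem mellin_logCutoff_one (k : ℕ) {s : ℂ} (hs : 0 < s.re) :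
    mellin (logCutoff (fun _ => 1) k) s = (k.factorial : ℂ) / s ^ (k + 1) := by
  induction k generalizing s with
  | zero =>
    have h := (hasMellin_one_Ioc hs).2
    simpa [logCutoff] using h
  | succ k ih =>
    have hs0 : s ≠ 0 := by rintro rfl; simp at hs
    have h1 := hasDerivAt_mellin_logCutoff (f := fun _ => 1) continuousOn_const (n := 0)
      (by simpa using Asymptotics.isBigO_const_const (1 : ℂ) (one_ne_zero (α := ℝ)) _) k
      (s := s) (by simpa using hs)
    have hev : mellin (logCutoff (fun _ => 1) k) =ᶠ[𝓝 s]
        fun z => (k.factorial : ℂ) / z ^ (k + 1) := by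
      filter_upwards [(isOpen_lt continuous_const continuous_re).mem_nhds hs] with z hz
      exact ih hz
    have h2 := ((hasDerivAt_pow (k + 1) s).fun_inv (pow_ne_zero _ hs0)).const_mul
      (k.factorial : ℂ)
    have h3 := (h1.congr_of_eventuallyEq hev.symm).unique
      (h2.congr_of_eventuallyEq (Eventually.of_forall fun z => div_eq_mul_inv _ _))
    rw [neg_eq_iff_eq_neg.1 h3, Nat.factorial_succ]
    push_cast
    field_simp
    ring

theorem mellin_logCutoff_pow (k n : ℕ) (s : ℂ) (hs : -(n : ℝ) < s.re) :
    mellin (logCutoff (fun x => (x : ℂ) ^ n) k) s = (k.factorial : ℂ) / (s + n) ^ (k + 1) := by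
  have heq : logCutoff (fun x => (x : ℂ) ^ n) k =
      fun t : ℝ => (t : ℂ) ^ (n : ℂ) • logCutoff (fun _ => 1) k t := by
    ext t
    by_cases ht : t ∈ Set.Ioc (0 : ℝ) 1
    · simp [logCutoff, Set.indicator_of_mem ht]
    · simp [logCutoff, Set.indicator_of_notMem ht]
  rw [heq, mellin_cpow_smul, mellin_logCutoff_one]
  simpa using by linarith

/-- The remainder of order `N` of `F (1 - x)` with respect to the coefficients `c`. -/
noncomputable def taylorRemainder (F : ℂ → ℂ) (c : ℕ → ℂ) (N : ℕ) (x : ℝ) : ℂ :=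
  F (1 - x) - ∑ j ∈ Finset.range N, c j * (x : ℂ) ^ j

theorem continuousOn_taylorRemainder {F : ℂ → ℂ}
    (hF : ContinuousOn F ((fun x : ℝ => (x : ℂ)) '' Set.Icc 0 1)) (c : ℕ → ℂ) (N : ℕ) :
    ContinuousOn (taylorRemainder F c N) (Set.Icc 0 1) := by
  refine ContinuousOn.sub (hF.comp (by fun_prop) fun x hx => ?_) (by fun_prop)
  exact ⟨1 - x, ⟨by linarith [hx.2], by linarith [hx.1]⟩, by simp⟩

theorem taylorRemainder_isBigO {F : ℂ → ℂ} {c : ℕ → ℂ} {r : ℝ} (hr : 0 < r)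
    (hF : ∀ t ∈ Metric.ball (1 : ℂ) r, HasSum (fun j : ℕ => c j * (1 - t) ^ j) (F t)) (N : ℕ) :
    taylorRemainder F c N =O[𝓝[>] 0] fun x : ℝ => x ^ N := by
  have hp : HasFPowerSeriesAt (fun z => F (1 - z)) (FormalMultilinearSeries.ofScalars ℂ c) 0 := by
    rw [hasFPowerSeriesAt_iff]
    filter_upwards [Metric.ball_mem_nhds (0 : ℂ) hr] with z hz
    have := hF (1 - z) (by simpa [dist_eq] using hz)
    simpa [mul_comm] using this
  have hlim : Tendsto (fun x : ℝ => (x : ℂ)) (𝓝[>] 0) (𝓝 0) :=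
    (continuous_ofReal.tendsto' 0 0 ofReal_zero).mono_left nhdsWithin_le_nhds
  have h := (hp.isBigO_sub_partialSum_pow N).comp_tendsto hlim
  refine Asymptotics.IsBigO.of_norm_right (h.congr' ?_ ?_)
  · refine Eventually.of_forall fun x => ?_
    simp [taylorRemainder, FormalMultilinearSeries.partialSum, mul_comm]
  · exact Eventually.of_forall fun x => by simp

/-- The continuation of the Mellin-type integral to the half-plane `-N - 1 < re s`. -/
noncomputable def logIntegralContinuation (F : ℂ → ℂ) (c : ℕ → ℂ) (k N : ℕ) (s : ℂ) : ℂ :=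
  ∑ j ∈ Finset.range N, (k.factorial : ℂ) * c j / (s + j + 1) ^ (k + 1) +
    mellin (logCutoff (taylorRemainder F c N) k) (s + 1)

theorem integral_eq_logIntegralContinuation_zero (F : ℂ → ℂ) (c : ℕ → ℂ) (k : ℕ) (s : ℂ) :
    ∫ t in Set.Ioo (0:ℝ) 1,
      F t * ((Real.log (1 / (1 - t)) : ℂ)) ^ k * ((1 - t : ℝ) : ℂ) ^ s =
      logIntegralContinuation F c k 0 s := by
  have h := intervalIntegral.integral_comp_sub_left (a := 0) (b := 1)
    (fun x : ℝ => F (1 - x) * ((-Real.log x : ℝ) : ℂ) ^ k * (x : ℂ) ^ s) 1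
  rw [sub_self, sub_zero, intervalIntegral.integral_of_le zero_le_one,
    intervalIntegral.integral_of_le zero_le_one, integral_Ioc_eq_integral_Ioo] at h
  calc
    _ = _ := by
      simp [Real.log_inv]
    _ = _ := h
    _ = _ := by
      simp only [logIntegralContinuation, mellin, logCutoff, Finset.range_zero, Finset.sum_empty,
        zero_add, add_sub_cancel_right, ← Set.indicator_smul]
      rw [setIntegral_indicator measurableSet_Ioc,
        Set.inter_eq_right.2 Set.Ioc_subset_Ioi_self]
      simp [taylorRemainder, mul_comm]

section Continuation

variable {F : ℂ → ℂ} {c : ℕ → ℂ} {r : ℝ}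

theorem logIntegralContinuation_succ (hr : 0 < r)
    (hF : ∀ t ∈ Metric.ball (1 : ℂ) r, HasSum (fun j : ℕ => c j * (1 - t) ^ j) (F t))
    (hFc : ContinuousOn F ((fun x : ℝ => (x : ℂ)) '' Set.Icc 0 1)) (k N : ℕ) {s : ℂ}
    (hs : -(N : ℝ) - 1 < s.re) :
    logIntegralContinuation F c k (N + 1) s = logIntegralContinuation F c k N s := by
  have hs' : -(N : ℝ) < (s + 1).re := by simpa using by linarith
  have hpow : MellinConvergent (logCutoff (fun x => (x : ℂ) ^ N) k) (s + 1) := by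
    refine mellinConvergent_logCutoff (n := N) (by fun_prop) ?_ k hs'
    exact Asymptotics.isBigO_of_le _ fun x => by simp
  have hrem : MellinConvergent (logCutoff (taylorRemainder F c (N + 1)) k) (s + 1) :=
    mellinConvergent_logCutoff (continuousOn_taylorRemainder hFc c _)
      (taylorRemainder_isBigO hr hF _) k (by push_cast; linarith)
  have hsplit : logCutoff (taylorRemainder F c N) k = fun t =>
      logCutoff (taylorRemainder F c (N + 1)) k t +
        c N • logCutoff (fun x => (x : ℂ) ^ N) k t := by
    ext t
    by_cases ht : t ∈ Set.Ioc (0 : ℝ) 1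
    · simp only [logCutoff, Set.indicator_of_mem ht, taylorRemainder, Finset.sum_range_succ,
        smul_eq_mul]
      ring
    · simp [logCutoff, Set.indicator_of_notMem ht]
  rw [logIntegralContinuation, logIntegralContinuation, hsplit,
    (hasMellin_add hrem (hpow.const_smul (c N))).2, mellin_const_smul,
    mellin_logCutoff_pow k N _ hs', Finset.sum_range_succ, smul_eq_mul, add_right_comm s 1]
  ring

theorem logIntegralContinuation_eq_of_le (hr : 0 < r)
    (hF : ∀ t ∈ Metric.ball (1 : ℂ) r, HasSum (fun j : ℕ => c j * (1 - t) ^ j) (F t))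
    (hFc : ContinuousOn F ((fun x : ℝ => (x : ℂ)) '' Set.Icc 0 1)) (k : ℕ) {N M : ℕ}
    (hNM : N ≤ M) {s : ℂ} (hs : -(N : ℝ) - 1 < s.re) :
    logIntegralContinuation F c k M s = logIntegralContinuation F c k N s := by
  induction M, hNM using Nat.le_induction with
  | base => rfl
  | succ M hM ih =>
    have : (N : ℝ) ≤ M := by exact_mod_cast hM
    rw [logIntegralContinuation_succ hr hF hFc k M (by linarith), ih]

theorem analyticAt_mellin_taylorRemainder (hr : 0 < r)
    (hF : ∀ t ∈ Metric.ball (1 : ℂ) r, HasSum (fun j : ℕ => c j * (1 - t) ^ j) (F t))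
    (hFc : ContinuousOn F ((fun x : ℝ => (x : ℂ)) '' Set.Icc 0 1)) (k N : ℕ) {s : ℂ}
    (hs : -(N : ℝ) - 1 < s.re) :
    AnalyticAt ℂ (fun z => mellin (logCutoff (taylorRemainder F c N) k) (z + 1)) s := by
  have hopen : IsOpen {z : ℂ | -(N : ℝ) < z.re} := isOpen_lt continuous_const continuous_re
  have hd : DifferentiableOn ℂ (mellin (logCutoff (taylorRemainder F c N) k))
      {z : ℂ | -(N : ℝ) < z.re} := fun z hz =>
    (hasDerivAt_mellin_logCutoff (continuousOn_taylorRemainder hFc c N)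
      (taylorRemainder_isBigO hr hF N) k hz).differentiableAt.differentiableWithinAt
  have h := hd.analyticAt (hopen.mem_nhds (x := s + 1)
    (by simpa using by linarith))
  exact h.fun_comp (f := fun z : ℂ => z + 1) (by fun_prop)

end Continuation

theorem analyticAt_sum_poles (c : ℕ → ℂ) (k N : ℕ) {s : ℂ}
    (hs : ∀ j < N, s ≠ -(j : ℂ) - 1) :
    AnalyticAt ℂ (fun z : ℂ => ∑ j ∈ Finset.range N,
      (k.factorial : ℂ) * c j / (z + j + 1) ^ (k + 1)) s := by
  refine Finset.analyticAt_fun_sum _ fun j hj => ?_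
  refine AnalyticAt.fun_div (by fun_prop) (by fun_prop) (pow_ne_zero _ fun h => ?_)
  exact hs j (Finset.mem_range.1 hj) (by linear_combination h)

open MeasureTheory Filter Topology Complex

/-- if `F` is holomorphic near `t = 1` with expansion
`F(t) = Σ_j F_j (1-t)^j`, continuous on `[0,1]`, and `k ≥ 0`, then
`I_k(s) = ∫₀¹ F(t)(log(1/(1-t)))^k (1-t)^s dt` (defined for `Re s > -1`)
extends to a meromorphic function on `ℂ` with poles of order `k+1` at each
`s = -j-1`, with principal part `k! F_j/(s+j+1)^{k+1}` there. -/
theorem integral_log_meromorphic_continuation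
    (F : ℂ → ℂ) (Fc : ℕ → ℂ) (r : ℝ) (hr : 0 < r) (k : ℕ)
    (hF : ∀ t ∈ Metric.ball (1:ℂ) r, HasSum (fun j : ℕ => Fc j * (1 - t) ^ j) (F t))
    (hFcont : ContinuousOn F ((fun x : ℝ => (x:ℂ)) '' Set.Icc 0 1)) :
    ∃ G : ℂ → ℂ,
      (∀ s : ℂ, -1 < s.re →
        G s = ∫ t in Set.Ioo (0:ℝ) 1,
          F t * ((Real.log (1 / (1 - t)) : ℂ)) ^ k * ((1 - t : ℝ) : ℂ) ^ s) ∧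
      (∀ s : ℂ, (∀ j : ℕ, s ≠ -(j:ℂ) - 1) → AnalyticAt ℂ G s) ∧
      (∀ j : ℕ, ∃ A : ℂ → ℂ, AnalyticAt ℂ A (-(j:ℂ) - 1) ∧
        ∀ᶠ s in 𝓝[≠] (-(j:ℂ) - 1),
          G s = (Nat.factorial k : ℂ) * Fc j / (s + (j:ℂ) + 1) ^ (k + 1) + A s) := by
  have hceil (s : ℂ) : -(⌈-s.re⌉₊ : ℝ) - 1 < s.re := by linarith [Nat.le_ceil (-s.re)]
  let G : ℂ → ℂ := fun s => logIntegralContinuation F Fc k ⌈-s.re⌉₊ s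
  have hG {N : ℕ} {s : ℂ} (hs : -(N : ℝ) - 1 < s.re) :
      G s = logIntegralContinuation F Fc k N s :=
    (logIntegralContinuation_eq_of_le hr hF hFcont k (le_max_left _ N) (hceil s)).symm.trans
      (logIntegralContinuation_eq_of_le hr hF hFcont k (le_max_right _ N) hs)
  have hGev {N : ℕ} {s : ℂ} (hs : -(N : ℝ) - 1 < s.re) :
      G =ᶠ[𝓝 s] logIntegralContinuation F Fc k N := by
    filter_upwards [(isOpen_lt continuous_const continuous_re).mem_nhds hs] with z hz
    exact hG hz
  refine ⟨G, fun s hs => ?_, fun s hs => ?_, fun j => ?_⟩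
  · rw [integral_eq_logIntegralContinuation_zero F Fc k s]
    exact hG (by simpa using hs)
  · refine AnalyticAt.congr ?_ (hGev (hceil s)).symm
    exact (analyticAt_sum_poles Fc k _ fun j _ => hs j).add
      (analyticAt_mellin_taylorRemainder hr hF hFcont k _ (hceil s))
  · have hj : -((j + 1 : ℕ) : ℝ) - 1 < (-(j : ℂ) - 1).re := by simp
    refine ⟨_, (analyticAt_sum_poles Fc k j fun i hi h => ?_).add
      (analyticAt_mellin_taylorRemainder hr hF hFcont k (j + 1) hj), ?_⟩
    · have : (j : ℂ) = i := by linear_combination -h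
      exact hi.ne' (by exact_mod_cast this)
    · filter_upwards [(hGev hj).filter_mono nhdsWithin_le_nhds] with s hs
      rw [hs, logIntegralContinuation, Finset.sum_range_succ]
      simp only [Pi.add_apply]
      ring
end
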